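/- For every noncomputable W ⊆ ℕ there exists a countable collection S of subsets of ℕ such that: (i) S contains every computable set; (ii) S is closed under Turing reducibility (if A ∈ S and B ≤_T A then B ∈ S) and under join (if A, B ∈ S then A ⊕ B ∈ S); (iii) for every 2-bounded coloring f : [ℕ]^3 → ℕ computable relative to some member of S, there is an infinite f-rainbow belonging to S; and (iv) W ∉ S. -/

import Mathlib

namespace RRT

/-- Partial functions on ℕ that are recursive in the oracle `O`.
This mirrors `Nat.Partrec`, with an extra constructor for the oracle. -/
inductive RecursiveIn (O : ℕ →. ℕ) : (ℕ →. ℕ) → Prop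
  | zero : RecursiveIn O (pure 0)
  | succ : RecursiveIn O Nat.succ
  | left : RecursiveIn O ↑fun n : ℕ => n.unpair.1
  | right : RecursiveIn O ↑fun n : ℕ => n.unpair.2
  | oracle : RecursiveIn O O
  | pair {f g} : RecursiveIn O f → RecursiveIn O g →
      RecursiveIn O fun n => Nat.pair <$> f n <*> g n
  | comp {f g} : RecursiveIn O f → RecursiveIn O g →
      RecursiveIn O fun n => g n >>= f
  | prec {f g} : RecursiveIn O f → RecursiveIn O g →
      RecursiveIn O (Nat.unpaired fun a n =>
        n.rec (f a) fun y IH => do let i ← IH; g (Nat.pair a (Nat.pair y i)))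
  | rfind {f} : RecursiveIn O f →
      RecursiveIn O fun a => Nat.rfind fun n => (fun m => m = 0) <$> f (Nat.pair a n)

/-- The characteristic function of a set of naturals. -/
noncomputable def chi (A : Set ℕ) : ℕ → ℕ := A.indicator fun _ => 1

/-- Turing reducibility `A ≤_T B` for sets of naturals: the characteristic function of `A`
is computable relative to an oracle for the characteristic function of `B`. -/
def TuringLE (A B : Set ℕ) : Prop := RecursiveIn (chi B) (chi A)

/-- The recursive join `A ⊕ B = {2n : n ∈ A} ∪ {2n+1 : n ∈ B}`. -/
def join (A B : Set ℕ) : Set ℕ :=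
  {n : ℕ | (∃ m ∈ A, n = 2 * m) ∨ (∃ m ∈ B, n = 2 * m + 1)}

/-- A total function `f : ℕ → ℕ` is computable relative to an oracle for `Z ⊆ ℕ`. -/
def FunRecIn (Z : Set ℕ) (f : ℕ → ℕ) : Prop := RecursiveIn (chi Z) f


/-- A coloring of `[ℕ]³` (identified with strictly increasing triples) is 2-bounded if
every color has at most 2 preimages. -/
def Bounded2Triples (f : ℕ → ℕ → ℕ → ℕ) : Prop :=
  ∀ c : ℕ, {t : ℕ × ℕ × ℕ | t.1 < t.2.1 ∧ t.2.1 < t.2.2 ∧ f t.1 t.2.1 t.2.2 = c}.encard ≤ 2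

/-- `X` is an `f`-rainbow for a coloring of triples: `f` is injective on `[X]³`. -/
def Rainbow3On (f : ℕ → ℕ → ℕ → ℕ) (X : Set ℕ) : Prop :=
  ∀ x₀ x₁ x₂ y₀ y₁ y₂ : ℕ, x₀ ∈ X → x₁ ∈ X → x₂ ∈ X → y₀ ∈ X → y₁ ∈ X → y₂ ∈ X →
    x₀ < x₁ → x₁ < x₂ → y₀ < y₁ → y₁ < y₂ →
    f x₀ x₁ x₂ = f y₀ y₁ y₂ → x₀ = y₀ ∧ x₁ = y₁ ∧ x₂ = y₂

end RRT

namespace RRT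
open Encodable

/-- The first `k` values of an oracle. -/
def pre (O : ℕ → ℕ) (k : ℕ) : List ℕ := (List.range k).map O

@[simp] theorem pre_length (O : ℕ → ℕ) (k : ℕ) : (pre O k).length = k := by simp [pre]

theorem pre_take (O : ℕ → ℕ) {j k : ℕ} (h : j ≤ k) : (pre O k).take j = pre O j := by
  simp [pre, ← List.map_take, List.take_range, Nat.min_eq_left h]

theorem pre_succ (O : ℕ → ℕ) (k : ℕ) : pre O (k+1) = pre O k ++ [O k] := by
  simp [pre, List.range_succ]

theorem pre_get? (O : ℕ → ℕ) (k n v : ℕ) : (pre O k)[n]? = some v ↔ n < k ∧ O n = v := by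
  simp only [pre, List.getElem?_map]
  by_cases h : n < k
  · simp [h]
  · simp [h]

theorem pre_congr {O O' : ℕ → ℕ} {k : ℕ} (h : ∀ n < k, O n = O' n) : pre O k = pre O' k := by
  simp only [pre]
  apply List.map_congr_left
  intro a ha
  exact h a (by simpa using ha)

theorem eq_pre_iff (O : ℕ → ℕ) (l : List ℕ) :
    l = pre O l.length ↔ ∀ j < l.length, l[j]? = some (O j) := by
  constructor
  · intro h j hj
    rw [h, pre_get?]
    exact ⟨by simpa using hj, rfl⟩
  · intro h
    apply List.ext_getElem?
    intro j
    by_cases hj : j < l.length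
    · rw [h j hj]; symm; rw [pre_get?]; exact ⟨hj, rfl⟩
    · rw [List.getElem?_eq_none (by omega), List.getElem?_eq_none (by simp; omega)]

/-- `Σ⁰₁` predicates relative to a family of oracles. -/
def Sig {ι α : Type} [Primcodable α] (O : ι → ℕ → ℕ) (S : ι → α → Prop) : Prop :=
  ∃ D : List ℕ × α → Prop, PrimrecPred D ∧ ∀ i a, S i a ↔ ∃ k, D (pre (O i) k, a)

section
variable {ι κ α β : Type} [Primcodable α] [Primcodable β] {O : ι → ℕ → ℕ} {S T : ι → α → Prop}

theorem Sig.of_eq (h : Sig O S) (e : ∀ i a, S i a ↔ T i a) : Sig O T := by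
  obtain ⟨D, hD, h⟩ := h
  exact ⟨D, hD, fun i a => (e i a).symm.trans (h i a)⟩

theorem Sig.mono (h : Sig O S) : ∃ D : List ℕ × α → Prop, PrimrecPred D ∧
    (∀ i a, S i a ↔ ∃ k, D (pre (O i) k, a)) ∧
    ∀ O' a j k, j ≤ k → D (pre O' j, a) → D (pre O' k, a) := by
  obtain ⟨D, hD, h⟩ := h
  refine ⟨fun p => ∃ j ∈ List.range (p.1.length + 1), D (p.1.take j, p.2), ?_, ?_, ?_⟩
  · have : PrimrecRel fun (j : ℕ) (p : List ℕ × α) => D (p.1.take j, p.2) :=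
      hD.comp (f := fun q : ℕ × List ℕ × α => (q.2.1.take q.1, q.2.2))
        ((Primrec.list_take.comp Primrec.fst (Primrec.fst.comp Primrec.snd)).pair
          (Primrec.snd.comp Primrec.snd))
    have h3 := this.exists_mem_list
    exact h3.comp (Primrec.list_range.comp
      (Primrec.succ.comp (Primrec.list_length.comp Primrec.fst))) Primrec.id
  · intro i a
    rw [h]
    constructor
    · rintro ⟨k, hk⟩
      exact ⟨k, k, by simp, by simpa [pre_take] using hk⟩
    · rintro ⟨k, j, hj, hk⟩
      simp only [pre_length, List.mem_range] at hj
      exact ⟨j, by simpa [pre_take (O i) (show j ≤ k by omega)] using hk⟩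
  · rintro O' a j k hjk ⟨m, hm, hd⟩
    simp only [pre_length, List.mem_range] at hm
    refine ⟨m, by simp; omega, ?_⟩
    simp only at hd ⊢
    rw [pre_take O' (by omega)] at hd ⊢
    exact hd

theorem Sig.prim {p : α → Prop} (h : PrimrecPred p) : Sig O (fun _ a => p a) :=
  ⟨fun q => p q.2, h.comp Primrec.snd, fun i a => by simp⟩

theorem Sig.and (h : Sig O S) (h' : Sig O T) : Sig O (fun i a => S i a ∧ T i a) := by
  obtain ⟨D, hD, h, m⟩ := h.mono
  obtain ⟨D', hD', h', m'⟩ := h'.mono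
  refine ⟨fun p => D p ∧ D' p, hD.and hD', fun i a => ?_⟩
  beta_reduce
  rw [h, h']
  constructor
  · rintro ⟨⟨k, hk⟩, k', hk'⟩
    exact ⟨max k k', m _ _ _ _ (le_max_left _ _) hk, m' _ _ _ _ (le_max_right _ _) hk'⟩
  · rintro ⟨k, h1, h2⟩
    exact ⟨⟨k, h1⟩, k, h2⟩

theorem Sig.or (h : Sig O S) (h' : Sig O T) : Sig O (fun i a => S i a ∨ T i a) := by
  obtain ⟨D, hD, h⟩ := h
  obtain ⟨D', hD', h'⟩ := h'
  refine ⟨fun p => D p ∨ D' p, hD.or hD', fun i a => ?_⟩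
  beta_reduce
  rw [h, h', exists_or]

theorem Sig.comp {S : ι → β → Prop} (h : Sig O S) {f : α → β} (hf : Primrec f) :
    Sig O (fun i a => S i (f a)) := by
  obtain ⟨D, hD, h⟩ := h
  exact ⟨fun p => D (p.1, f p.2), hD.comp (Primrec.fst.pair (hf.comp Primrec.snd)),
    fun i a => h i (f a)⟩

theorem Sig.reindex (h : Sig O S) (f : κ → ι) : Sig (fun k => O (f k)) (fun k a => S (f k) a) := by
  obtain ⟨D, hD, h⟩ := h
  exact ⟨D, hD, fun i a => h (f i) a⟩

theorem Sig.ex {S : ι → α → β → Prop} (h : Sig O (fun i (p : α × β) => S i p.1 p.2)) :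
    Sig O (fun i a => ∃ b, S i a b) := by
  obtain ⟨D, hD, h, m⟩ := h.mono
  refine ⟨fun p => ∃ n ∈ List.range p.1.length, ∃ b ∈ (decode (α := β) n).toList, D (p.1, (p.2, b)), ?_, ?_⟩
  · have h1 : PrimrecRel fun (b : β) (p : List ℕ × α) => D (p.1, (p.2, b)) :=
      hD.comp (f := fun q : β × List ℕ × α => (q.2.1, (q.2.2, q.1)))
        ((Primrec.fst.comp Primrec.snd).pair ((Primrec.snd.comp Primrec.snd).pair Primrec.fst))
    have h2 : PrimrecRel fun (n : ℕ) (p : List ℕ × α) =>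
        ∃ b ∈ (decode (α := β) n).toList, D (p.1, (p.2, b)) :=
      h1.exists_mem_list.comp (Primrec.optionToList.comp (Primrec.decode.comp Primrec.fst))
        Primrec.snd
    have h3 := h2.exists_mem_list
    exact h3.comp (Primrec.list_range.comp (Primrec.list_length.comp Primrec.fst)) Primrec.id
  · intro i a
    constructor
    · rintro ⟨b, hb⟩
      obtain ⟨k, hk⟩ := (h i (a, b)).1 hb
      refine ⟨max k (encode b + 1), encode b, by simp, b, by simp, ?_⟩
      exact m _ _ _ _ (le_max_left _ _) hk
    · rintro ⟨k, n, hn, b, hb, hd⟩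
      exact ⟨b, (h i (a, b)).2 ⟨k, hd⟩⟩

theorem Sig.ball {S : ι → α → β → Prop} (h : Sig O (fun i (p : α × β) => S i p.1 p.2))
    {l : α → List β} (hl : Primrec l) :
    Sig O (fun i a => ∀ b ∈ l a, S i a b) := by
  obtain ⟨D, hD, h, m⟩ := h.mono
  refine ⟨fun p => ∀ b ∈ l p.2, D (p.1, (p.2, b)), ?_, ?_⟩
  · have h1 : PrimrecRel fun (b : β) (p : List ℕ × α) => D (p.1, (p.2, b)) :=
      hD.comp (f := fun q : β × List ℕ × α => (q.2.1, (q.2.2, q.1)))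
        ((Primrec.fst.comp Primrec.snd).pair ((Primrec.snd.comp Primrec.snd).pair Primrec.fst))
    exact h1.forall_mem_list.comp (hl.comp Primrec.snd) Primrec.id
  · intro i a
    constructor
    · intro hb
      have key : ∀ L : List β, (∀ b ∈ L, S i a b) → ∃ k, ∀ b ∈ L, D (pre (O i) k, (a, b)) := by
        intro L
        induction L with
        | nil => intro _; exact ⟨0, by simp⟩
        | cons x L ih =>
          intro hL
          obtain ⟨k, hk⟩ := ih (fun b hb => hL b (List.mem_cons_of_mem _ hb))
          obtain ⟨k', hk'⟩ := (h i (a, x)).1 (hL x List.mem_cons_self)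
          refine ⟨max k k', fun b hb => ?_⟩
          rcases List.mem_cons.1 hb with rfl | hb
          · exact m _ _ _ _ (le_max_right _ _) hk'
          · exact m _ _ _ _ (le_max_left _ _) (hk b hb)
      exact key _ hb
    · rintro ⟨k, hk⟩ b hb
      exact (h i (a, b)).2 ⟨k, hk b hb⟩

theorem Sig.orc {f g : α → ℕ} (hf : Primrec f) (hg : Primrec g) :
    Sig O (fun i a => O i (f a) = g a) := by
  refine ⟨fun p => p.1[f p.2]? = some (g p.2), ?_, ?_⟩
  · exact Primrec.eq.comp
      (Primrec.list_getElem?.comp Primrec.fst (hf.comp Primrec.snd))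
      (Primrec.option_some.comp (hg.comp Primrec.snd))
  · intro i a
    simp only [pre_get?]
    constructor
    · intro h; exact ⟨f a + 1, by omega, h⟩
    · rintro ⟨k, _, h⟩; exact h

/-- the r.e. operator given by a primitive recursive predicate -/
def op {β : Type} (D : List ℕ × β → Prop) (O : ℕ → ℕ) (b : β) : Prop := ∃ k, D (pre O k, b)

theorem Sig.op {D : List ℕ × β → Prop} (hD : PrimrecPred D) {g : ι → α → ℕ → ℕ}
    (hg : Sig O (fun i (p : α × ℕ × ℕ) => g i p.1 p.2.1 = p.2.2)) {f : α → β} (hf : Primrec f) :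
    Sig O (fun i a => op D (g i a) (f a)) := by
  have h1 : Sig O (fun i (a : α) => ∃ l : List ℕ, D (l, f a) ∧
      ∀ j ∈ List.range l.length, ∃ v, l[j]? = some v ∧ g i a j = v) := by
    apply Sig.ex (S := fun i a (l : List ℕ) => D (l, f a) ∧
      ∀ j ∈ List.range l.length, ∃ v, l[j]? = some v ∧ g i a j = v)
    apply Sig.and
    · exact Sig.prim (hD.comp (f := fun p : α × List ℕ => (p.2, f p.1))
        (Primrec.snd.pair (hf.comp Primrec.fst)))
    · apply Sig.ball (S := fun i (p : α × List ℕ) j => ∃ v, p.2[j]? = some v ∧ g i p.1 j = v)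
      · apply Sig.ex (S := fun i (q : (α × List ℕ) × ℕ) v => q.1.2[q.2]? = some v ∧ g i q.1.1 q.2 = v)
        apply Sig.and
        · apply Sig.prim (p := fun q : ((α × List ℕ) × ℕ) × ℕ => q.1.1.2[q.1.2]? = some q.2)
          exact Primrec.eq.comp (Primrec.list_getElem?.comp
            (Primrec.snd.comp (Primrec.fst.comp Primrec.fst)) (Primrec.snd.comp Primrec.fst))
            (Primrec.option_some.comp Primrec.snd)
        · exact hg.comp (f := fun q : ((α × List ℕ) × ℕ) × ℕ => (q.1.1.1, q.1.2, q.2))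
            ((Primrec.fst.comp (Primrec.fst.comp Primrec.fst)).pair
              ((Primrec.snd.comp Primrec.fst).pair Primrec.snd))
      · exact Primrec.list_range.comp (Primrec.list_length.comp Primrec.snd)
  refine h1.of_eq fun i a => ?_
  constructor
  · rintro ⟨l, hl, h⟩
    refine ⟨l.length, ?_⟩
    rwa [← (eq_pre_iff (g i a) l).2]
    intro j hj
    obtain ⟨v, h1, rfl⟩ := h j (by simpa using hj)
    exact h1
  · rintro ⟨k, hk⟩
    refine ⟨_, hk, fun j hj => ⟨_, ?_, rfl⟩⟩
    rw [pre_get?]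
    exact ⟨by simpa using hj, rfl⟩

/-- family reducibility -/
def LeF (O' O : ι → ℕ → ℕ) : Prop := Sig O (fun i (p : ℕ × ℕ) => O' i p.1 = p.2)

theorem LeF.sig {O' : ι → ℕ → ℕ} (h : LeF O' O) (hS : Sig O' S) : Sig O S := by
  obtain ⟨D, hD, hS⟩ := hS
  refine (Sig.op (g := fun i _ => O' i) hD ?_ Primrec.id).of_eq fun i a => (hS i a).symm
  exact h.comp (f := fun p : α × ℕ × ℕ => p.2) Primrec.snd

theorem LeF.refl : LeF O O := Sig.orc Primrec.fst Primrec.snd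

theorem LeF.trans {O₁ O₂ O₃ : ι → ℕ → ℕ} (h : LeF O₁ O₂) (hh : LeF O₂ O₃) : LeF O₁ O₃ :=
  hh.sig h

/-- pairing of oracles -/
def opair (A B : ℕ → ℕ) : ℕ → ℕ := fun n => Nat.pair (A n) (B n)

theorem LeF.left {A B : ι → ℕ → ℕ} : LeF A (fun i => opair (A i) (B i)) := by
  have : Sig (fun i => opair (A i) (B i)) (fun i (p : ℕ × ℕ) => ∃ v, opair (A i) (B i) p.1 = Nat.pair p.2 v) := by
    apply Sig.ex (S := fun i (p : ℕ × ℕ) v => opair (A i) (B i) p.1 = Nat.pair p.2 v)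
    exact Sig.orc (Primrec.fst.comp Primrec.fst)
      (Primrec₂.natPair.comp (Primrec.snd.comp Primrec.fst) Primrec.snd)
  refine this.of_eq fun i p => ?_
  simp [opair, Nat.pair_eq_pair]

theorem LeF.right {A B : ι → ℕ → ℕ} : LeF B (fun i => opair (A i) (B i)) := by
  have : Sig (fun i => opair (A i) (B i)) (fun i (p : ℕ × ℕ) => ∃ v, opair (A i) (B i) p.1 = Nat.pair v p.2) := by
    apply Sig.ex (S := fun i (p : ℕ × ℕ) v => opair (A i) (B i) p.1 = Nat.pair v p.2)
    exact Sig.orc (Primrec.fst.comp Primrec.fst)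
      (Primrec₂.natPair.comp Primrec.snd (Primrec.snd.comp Primrec.fst))
  refine this.of_eq fun i p => ?_
  simp [opair, Nat.pair_eq_pair]

/-- graph of the pairing, with parameters -/
theorem Sig.opair {A B : ι → α → ℕ → ℕ}
    (hA : Sig O (fun i (p : α × ℕ × ℕ) => A i p.1 p.2.1 = p.2.2))
    (hB : Sig O (fun i (p : α × ℕ × ℕ) => B i p.1 p.2.1 = p.2.2)) :
    Sig O (fun i (p : α × ℕ × ℕ) => opair (A i p.1) (B i p.1) p.2.1 = p.2.2) := by
  have e : Primrec (fun p : α × ℕ × ℕ => (p.1, p.2.1, p.2.2.unpair.1)) :=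
    Primrec.fst.pair ((Primrec.fst.comp Primrec.snd).pair
      (Primrec.fst.comp (Primrec.unpair.comp (Primrec.snd.comp Primrec.snd))))
  have e' : Primrec (fun p : α × ℕ × ℕ => (p.1, p.2.1, p.2.2.unpair.2)) :=
    Primrec.fst.pair ((Primrec.fst.comp Primrec.snd).pair
      (Primrec.snd.comp (Primrec.unpair.comp (Primrec.snd.comp Primrec.snd))))
  refine ((hA.comp e).and (hB.comp e')).of_eq fun i p => ?_
  simp only [RRT.opair]
  constructor
  · rintro ⟨h1, h2⟩; rw [h1, h2, Nat.pair_unpair]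
  · intro h; rw [← h]; simp

theorem LeF.pair {A B : ι → ℕ → ℕ} (hA : LeF A O) (hB : LeF B O) :
    LeF (fun i => opair (A i) (B i)) O := by
  have := Sig.opair (α := Unit) (A := fun i _ => A i) (B := fun i _ => B i)
    (hA.comp (f := fun p : Unit × ℕ × ℕ => p.2) Primrec.snd)
    (hB.comp (f := fun p : Unit × ℕ × ℕ => p.2) Primrec.snd)
  exact this.comp (f := fun p : ℕ × ℕ => ((), p)) ((Primrec.const ()).pair Primrec.id)

end
end RRT

namespace RRT
open Encodable

/-! ### Link with `RecursiveIn` -/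

theorem RecursiveIn.of_eq' {O f g} (hf : RecursiveIn O f) (h : ∀ n, f n = g n) :
    RecursiveIn O g := (funext h : f = g) ▸ hf

theorem RecursiveIn.comp_tot {O} {f g : ℕ → ℕ} (hf : RecursiveIn O f) (hg : RecursiveIn O g) :
    RecursiveIn O ((fun n => f (g n) : ℕ → ℕ) : ℕ →. ℕ) :=
  (RecursiveIn.comp hf hg).of_eq' fun n => Part.bind_some (g n) (f : ℕ →. ℕ)

theorem RecursiveIn.pair_tot {O} {f g : ℕ → ℕ} (hf : RecursiveIn O f) (hg : RecursiveIn O g) :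
    RecursiveIn O ((fun n => Nat.pair (f n) (g n) : ℕ → ℕ) : ℕ →. ℕ) :=
  (RecursiveIn.pair hf hg).of_eq' fun n => by simp [Seq.seq]

theorem RecursiveIn.prec_tot {O} {f g : ℕ → ℕ} (hf : RecursiveIn O f) (hg : RecursiveIn O g) :
    RecursiveIn O ((Nat.unpaired fun a n =>
        n.rec (f a) fun y i => g (Nat.pair a (Nat.pair y i)) : ℕ → ℕ) : ℕ →. ℕ) :=
  (RecursiveIn.prec hf hg).of_eq' fun n => by
    simp only [Nat.unpaired, PFun.coe_val]
    induction n.unpair.2 with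
    | zero => simp
    | succ m ih =>
      refine Eq.trans (congrArg (fun q : Part ℕ => q.bind fun i =>
        Part.some (g (Nat.pair (Nat.unpair n).1 (Nat.pair m i)))) ih) ?_
      exact Part.bind_some _ _

theorem RecursiveIn.of_prim {O} {f : ℕ → ℕ} (hf : Nat.Primrec f) : RecursiveIn O f := by
  induction hf with
  | zero => exact RecursiveIn.zero
  | succ => exact RecursiveIn.succ
  | left => exact RecursiveIn.left
  | right => exact RecursiveIn.right
  | pair _ _ h1 h2 => exact h1.pair_tot h2
  | comp _ _ h1 h2 => exact h1.comp_tot h2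
  | prec _ _ h1 h2 => exact h1.prec_tot h2

/-- single oracle versions -/
abbrev Sg {α : Type} [Primcodable α] (O : ℕ → ℕ) (S : α → Prop) : Prop :=
  Sig (fun _ : Unit => O) (fun _ a => S a)

abbrev Le (O' O : ℕ → ℕ) : Prop := LeF (fun _ : Unit => O') (fun _ : Unit => O)

theorem Sg.of_rec {O : ℕ → ℕ} {f : ℕ →. ℕ} (hf : RecursiveIn O f) :
    Sg O (fun p : ℕ × ℕ => p.2 ∈ f p.1) := by
  have hp12 : Primrec (fun q : (ℕ × ℕ) × ℕ => q.1.1) := Primrec.fst.comp Primrec.fst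
  induction hf with
  | zero =>
    refine (Sig.prim (p := fun p : ℕ × ℕ => p.2 = 0) ?_).of_eq fun i p => ?_
    · exact Primrec.eq.comp Primrec.snd (Primrec.const 0)
    · change _ ↔ p.2 ∈ Part.some 0; simp
  | succ =>
    refine (Sig.prim (p := fun p : ℕ × ℕ => p.2 = p.1.succ) ?_).of_eq fun i p => ?_
    · exact Primrec.eq.comp Primrec.snd (Primrec.succ.comp Primrec.fst)
    · simp
  | left =>
    refine (Sig.prim (p := fun p : ℕ × ℕ => p.2 = p.1.unpair.1) ?_).of_eq fun i p => ?_
    · exact Primrec.eq.comp Primrec.snd (Primrec.fst.comp (Primrec.unpair.comp Primrec.fst))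
    · simp
  | right =>
    refine (Sig.prim (p := fun p : ℕ × ℕ => p.2 = p.1.unpair.2) ?_).of_eq fun i p => ?_
    · exact Primrec.eq.comp Primrec.snd (Primrec.snd.comp (Primrec.unpair.comp Primrec.fst))
    · simp
  | oracle =>
    refine (Sig.orc (O := fun _ : Unit => O) Primrec.fst Primrec.snd).of_eq fun i p => ?_
    simp [eq_comm]
  | @pair f g _ _ h1 h2 =>
    refine Sig.of_eq (S := fun _ (p : ℕ × ℕ) => p.2.unpair.1 ∈ f p.1 ∧ p.2.unpair.2 ∈ g p.1) ?_
      fun i p => ?_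
    · exact (h1.comp (f := fun p : ℕ × ℕ => (p.1, p.2.unpair.1)) (Primrec.fst.pair
        (Primrec.fst.comp (Primrec.unpair.comp Primrec.snd)))).and
        (h2.comp (f := fun p : ℕ × ℕ => (p.1, p.2.unpair.2)) (Primrec.fst.pair
        (Primrec.snd.comp (Primrec.unpair.comp Primrec.snd))))
    · simp only [Seq.seq, Part.map_eq_map, Part.mem_bind_iff, Part.mem_map_iff]
      constructor
      · rintro ⟨ha, hb⟩
        exact ⟨_, ⟨_, ha, rfl⟩, _, hb, by simp⟩
      · rintro ⟨_, ⟨a, ha, rfl⟩, b, hb, h⟩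
        rw [← h]; simpa using ⟨ha, hb⟩
  | @comp f g _ _ h1 h2 =>
    refine Sig.of_eq (S := fun _ (p : ℕ × ℕ) => ∃ v, v ∈ g p.1 ∧ p.2 ∈ f v) ?_ fun i p => ?_
    · apply Sig.ex (S := fun (_ : Unit) (p : ℕ × ℕ) v => v ∈ g p.1 ∧ p.2 ∈ f v)
      exact (h2.comp (f := fun q : (ℕ × ℕ) × ℕ => (q.1.1, q.2)) (hp12.pair Primrec.snd)).and
        (h1.comp (f := fun q : (ℕ × ℕ) × ℕ => (q.2, q.1.2))
          (Primrec.snd.pair (Primrec.snd.comp Primrec.fst)))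
    · exact (Part.mem_bind_iff (f := g p.1) (g := f)).symm
  | @prec f g _ _ h1 h2 =>
    refine Sig.of_eq (S := fun _ (p : ℕ × ℕ) => ∃ c : List ℕ, (c.getD 0 0 ∈ f p.1.unpair.1 ∧
      c.getD p.1.unpair.2 0 = p.2) ∧ ∀ y ∈ List.range p.1.unpair.2,
        c.getD (y + 1) 0 ∈ g (Nat.pair p.1.unpair.1 (Nat.pair y (c.getD y 0)))) ?_ fun i p => ?_
    · have e1 : Primrec (fun q : (ℕ × ℕ) × List ℕ => q.1.1.unpair.1) :=
        Primrec.fst.comp (Primrec.unpair.comp (Primrec.fst.comp Primrec.fst))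
      have e2 : Primrec (fun q : (ℕ × ℕ) × List ℕ => q.1.1.unpair.2) :=
        Primrec.snd.comp (Primrec.unpair.comp (Primrec.fst.comp Primrec.fst))
      apply Sig.ex (S := fun (_ : Unit) (p : ℕ × ℕ) (c : List ℕ) => (c.getD 0 0 ∈ f p.1.unpair.1 ∧
        c.getD p.1.unpair.2 0 = p.2) ∧ ∀ y ∈ List.range p.1.unpair.2,
        c.getD (y + 1) 0 ∈ g (Nat.pair p.1.unpair.1 (Nat.pair y (c.getD y 0))))
      apply Sig.and
      · apply Sig.and
        · exact h1.comp (f := fun q : (ℕ × ℕ) × List ℕ => (q.1.1.unpair.1, q.2.getD 0 0))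
            (e1.pair ((Primrec.list_getD 0).comp Primrec.snd (Primrec.const 0)))
        · apply Sig.prim (p := fun q : (ℕ × ℕ) × List ℕ => q.2.getD q.1.1.unpair.2 0 = q.1.2)
          exact Primrec.eq.comp ((Primrec.list_getD 0).comp Primrec.snd e2)
            (Primrec.snd.comp Primrec.fst)
      · apply Sig.ball (S := fun (_ : Unit) (q : (ℕ × ℕ) × List ℕ) y =>
          q.2.getD (y + 1) 0 ∈ g (Nat.pair q.1.1.unpair.1 (Nat.pair y (q.2.getD y 0))))
        · refine h2.comp (f := fun q : ((ℕ × ℕ) × List ℕ) × ℕ =>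
            (Nat.pair q.1.1.1.unpair.1 (Nat.pair q.2 (q.1.2.getD q.2 0)), q.1.2.getD (q.2 + 1) 0)) ?_
          refine (Primrec₂.natPair.comp (e1.comp Primrec.fst) (Primrec₂.natPair.comp Primrec.snd
            ((Primrec.list_getD 0).comp (Primrec.snd.comp Primrec.fst) Primrec.snd))).pair
            ((Primrec.list_getD 0).comp (Primrec.snd.comp Primrec.fst)
              (Primrec.succ.comp Primrec.snd))
        · exact Primrec.list_range.comp e2
    · obtain ⟨x, v⟩ := p
      simp only [Nat.unpaired]
      generalize x.unpair.1 = a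
      generalize x.unpair.2 = n
      constructor
      · rintro ⟨c, ⟨h0, hn⟩, hs⟩
        have : ∀ y ≤ n, c.getD y 0 ∈ (Nat.rec (f a) (fun y IH => do
            let i ← IH; g (Nat.pair a (Nat.pair y i))) y : Part ℕ) := by
          intro y
          induction y with
          | zero => intro _; exact h0
          | succ y ih =>
            intro hy
            exact Part.mem_bind (ih (by omega)) (hs y (by simpa using hy))
        rw [← hn]
        exact this n le_rfl
      · intro h
        have : ∀ n v, v ∈ (Nat.rec (f a) (fun y IH => do
            let i ← IH; g (Nat.pair a (Nat.pair y i))) n : Part ℕ) → ∃ c : List ℕ, c.length = n + 1 ∧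
            (c.getD 0 0 ∈ f a ∧ c.getD n 0 = v) ∧ ∀ y ∈ List.range n,
              c.getD (y + 1) 0 ∈ g (Nat.pair a (Nat.pair y (c.getD y 0))) := by
          intro n
          induction n with
          | zero => intro v hv; exact ⟨[v], rfl, ⟨hv, rfl⟩, by simp⟩
          | succ n ih =>
            intro v hv
            obtain ⟨i, hi, hv⟩ := Part.mem_bind_iff.1 hv
            obtain ⟨c, hl, ⟨h0, hn⟩, hs⟩ := ih i hi
            have happ : ∀ j ≤ n, (c ++ [v]).getD j 0 = c.getD j 0 := by
              intro j hj
              rw [List.getD_append _ _ _ _ (by omega)]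
            have hlast : (c ++ [v]).getD (n + 1) 0 = v := by
              rw [List.getD_append_right _ _ _ _ (by omega)]; simp [hl]
            refine ⟨c ++ [v], by simp [hl], ⟨?_, hlast⟩, ?_⟩
            · rw [happ 0 (by omega)]; exact h0
            · intro y hy
              rw [List.mem_range] at hy
              rw [happ y (by omega)]
              rcases Nat.lt_succ_iff_lt_or_eq.1 hy with h | rfl
              · rw [happ (y+1) (by omega)]; exact hs y (by simpa using h)
              · rw [hlast, hn]; exact hv
        obtain ⟨c, _, h⟩ := this n v h
        exact ⟨c, h⟩
  | @rfind f _ h1 =>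
    refine Sig.of_eq (S := fun _ (p : ℕ × ℕ) => 0 ∈ f (Nat.pair p.1 p.2) ∧
      ∀ y ∈ List.range p.2, ∃ v, v + 1 ∈ f (Nat.pair p.1 y)) ?_ fun i p => ?_
    · apply Sig.and
      · exact h1.comp (f := fun p : ℕ × ℕ => (Nat.pair p.1 p.2, 0))
          ((Primrec₂.natPair.comp Primrec.fst Primrec.snd).pair (Primrec.const 0))
      · apply Sig.ball (S := fun (_ : Unit) (p : ℕ × ℕ) y => ∃ v, v + 1 ∈ f (Nat.pair p.1 y))
        · apply Sig.ex (S := fun (_ : Unit) (p : (ℕ × ℕ) × ℕ) v => v + 1 ∈ f (Nat.pair p.1.1 p.2))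
          exact h1.comp (f := fun p : ((ℕ × ℕ) × ℕ) × ℕ => (Nat.pair p.1.1.1 p.1.2, p.2 + 1))
            ((Primrec₂.natPair.comp (Primrec.fst.comp (Primrec.fst.comp Primrec.fst))
              (Primrec.snd.comp Primrec.fst)).pair (Primrec.succ.comp Primrec.snd))
        · exact Primrec.list_range.comp Primrec.snd
    · change _ ↔ p.2 ∈ Nat.rfind fun n => (fun m => decide (m = 0)) <$> f (Nat.pair p.1 n)
      refine Iff.trans ?_ Nat.mem_rfind.symm
      simp only [Part.map_eq_map, Part.mem_map_iff, List.mem_range]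
      apply and_congr
      · simp
      · apply forall_congr'; intro y
        apply imp_congr_right; intro _
        constructor
        · rintro ⟨v, hv⟩; exact ⟨_, hv, by simp⟩
        · rintro ⟨v, hv, h⟩
          simp only [decide_eq_false_iff_not] at h
          exact ⟨v - 1, by rwa [Nat.sub_add_cancel (by omega)]⟩

theorem Le.of_rec {O f : ℕ → ℕ} (h : RecursiveIn O f) : Le f O :=
  (Sg.of_rec h).of_eq fun _ p => by simp [eq_comm]

theorem Le.rec {O f : ℕ → ℕ} (h : Le f O) : RecursiveIn O f := by
  obtain ⟨D, hD, h⟩ := h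
  have h : ∀ n v, f n = v ↔ ∃ k, D (pre O k, (n, v)) := fun n v => h () (n, v)
  have hc : RecursiveIn O ((fun k => encode (pre O k) : ℕ → ℕ) : ℕ →. ℕ) := by
    have happ : Nat.Primrec (fun x : ℕ => encode (((decode (α := List ℕ) x.unpair.1).getD []) ++ [x.unpair.2])) := by
      apply Primrec.nat_iff.1
      apply Primrec.encode.comp
      apply Primrec.list_append.comp
      · exact Primrec.option_getD.comp (Primrec.decode.comp (Primrec.fst.comp Primrec.unpair)) (Primrec.const [])
      · exact Primrec.list_cons.comp (Primrec.snd.comp Primrec.unpair) (Primrec.const [])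
    have hy : RecursiveIn O ((fun x : ℕ => x.unpair.2.unpair.1 : ℕ → ℕ) : ℕ →. ℕ) :=
      RecursiveIn.of_prim (Primrec.nat_iff.1 (Primrec.fst.comp (Primrec.unpair.comp (Primrec.snd.comp Primrec.unpair))))
    have hi : RecursiveIn O ((fun x : ℕ => x.unpair.2.unpair.2 : ℕ → ℕ) : ℕ →. ℕ) :=
      RecursiveIn.of_prim (Primrec.nat_iff.1 (Primrec.snd.comp (Primrec.unpair.comp (Primrec.snd.comp Primrec.unpair))))
    have hg := (RecursiveIn.of_prim (O := O) happ).comp_tot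
      (hi.pair_tot (RecursiveIn.comp_tot (f := O) RecursiveIn.oracle hy))
    have hr := RecursiveIn.prec_tot (O := O) (f := fun _ => encode ([] : List ℕ))
      (RecursiveIn.of_prim (Primrec.nat_iff.1 (Primrec.const _))) hg
    have hr2 := hr.comp_tot (g := fun k => Nat.pair 0 k)
      (RecursiveIn.of_prim (Primrec.nat_iff.1 (Primrec₂.natPair.comp (Primrec.const 0) Primrec.id)))
    refine hr2.of_eq' fun k => ?_
    simp only [PFun.coe_val, Nat.unpaired, Nat.unpair_pair, Part.some_inj]
    induction k with
    | zero => rfl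
    | succ k ih =>
      rw [pre_succ]
      simp only [ih]
      simp
  classical
  have hu : Nat.Primrec (fun x : ℕ =>
      if D ((decode (α := List ℕ) x.unpair.2).getD [], (x.unpair.1.unpair.1, x.unpair.1.unpair.2.unpair.2))
      then 0 else 1) := by
    apply Primrec.nat_iff.1
    apply Primrec.ite
    · apply hD.comp
      have e1 : Primrec (fun x : ℕ => x.unpair.1.unpair) :=
        Primrec.unpair.comp (Primrec.fst.comp Primrec.unpair)
      exact (Primrec.option_getD.comp (Primrec.decode.comp (Primrec.snd.comp Primrec.unpair)) (Primrec.const [])).pair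
        ((Primrec.fst.comp e1).pair (Primrec.snd.comp (Primrec.unpair.comp (Primrec.snd.comp e1))))
    · exact Primrec.const 0
    · exact Primrec.const 1
  have hk : RecursiveIn O ((fun x : ℕ => x.unpair.2.unpair.1 : ℕ → ℕ) : ℕ →. ℕ) :=
      RecursiveIn.of_prim (Primrec.nat_iff.1 (Primrec.fst.comp (Primrec.unpair.comp (Primrec.snd.comp Primrec.unpair))))
  have hid : RecursiveIn O ((fun x : ℕ => x : ℕ → ℕ) : ℕ →. ℕ) :=
      RecursiveIn.of_prim (Primrec.nat_iff.1 Primrec.id)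
  have ht := (RecursiveIn.of_prim (O := O) hu).comp_tot (hid.pair_tot (hc.comp_tot hk))
  have hr := RecursiveIn.comp (RecursiveIn.right) (RecursiveIn.rfind ht)
  refine hr.of_eq' fun n => ?_
  rw [PFun.coe_val, Part.eq_some_iff]
  change f n ∈ Part.bind _ _
  refine Part.mem_bind_iff.2 ?_
  obtain ⟨k, hk⟩ := (h n (f n)).1 rfl
  have hdom : (Nat.rfind fun m => (fun m => decide (m = 0)) <$> (((fun x : ℕ => if D ((decode (α := List ℕ) (Nat.pair x (encode (pre O x.unpair.2.unpair.1))).unpair.2).getD [], ((Nat.pair x (encode (pre O x.unpair.2.unpair.1))).unpair.1.unpair.1, (Nat.pair x (encode (pre O x.unpair.2.unpair.1))).unpair.1.unpair.2.unpair.2))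
      then 0 else 1 : ℕ → ℕ) : ℕ →. ℕ) (Nat.pair n m))).Dom := by
    refine Nat.rfind_dom.2 ?_
    refine ⟨Nat.pair k (f n), ?_, ?_⟩
    · simp [hk]
    · intros; simp
  obtain ⟨m, hm⟩ := Part.dom_iff_mem.1 hdom
  refine ⟨m, hm, ?_⟩
  have := (Nat.mem_rfind.1 hm).1
  simp at this
  have := (h n _).2 ⟨_, this⟩
  simp [this]

end RRT

namespace RRT
open Encodable

/-! ### Cone avoidance -/

/-- `O` does not compute `w` -/
def Av (w O : ℕ → ℕ) : Prop := ¬ Le w O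

theorem Av.anti {w O O' : ℕ → ℕ} (h : Av w O) (h' : Le O' O) : Av w O' :=
  fun hw => h (hw.trans h')

theorem Av.dich {w O : ℕ → ℕ} (h : Av w O) {S : ℕ × ℕ → Prop} (hS : Sg O S) :
    ∃ n, (∃ i, i ≠ w n ∧ S (n, i)) ∨ ¬ S (n, w n) := by
  by_contra hc
  push Not at hc
  apply h
  refine Sig.of_eq hS fun _ p => ?_
  obtain ⟨n, i⟩ := p
  constructor
  · intro hs
    by_contra hne
    exact (hc n).1 i (fun e => hne e.symm) hs
  · intro e
    have e : w n = i := e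
    rw [← e]
    exact (hc n).2

/-- indices of reductions -/
abbrev PD : Type := {D : List ℕ × ℕ × ℕ → Prop // PrimrecPred D}

/-- the requirement -/
def Req (w : ℕ → ℕ) (D : PD) (O : ℕ → ℕ) : Prop :=
  ∃ n, (∃ i, i ≠ w n ∧ op D.1 O (n, i)) ∨ ¬ op D.1 O (n, w n)

theorem Av.of_req {w O : ℕ → ℕ} (h : ∀ D, Req w D O) : Av w O := by
  rintro ⟨D, hD, hw⟩
  obtain ⟨n, ⟨i, hi, h⟩ | h⟩ := h ⟨D, hD⟩
  · exact hi ((hw () (n, i)).2 h).symm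
  · exact h ((hw () (n, w n)).1 rfl)

theorem countable_prim {α : Type} [Primcodable α] :
    Countable {D : α → Prop // PrimrecPred D} := by
  classical
  have : ∀ D : {D : α → Prop // PrimrecPred D}, ∃ g : {f : ℕ → ℕ // Computable f},
      ∀ a, (D.1 a ↔ g.1 (encode a) = encode (some true)) := by
    rintro ⟨D, hd, hD⟩
    refine ⟨⟨_, (Primrec.nat_iff.2 hD).to_comp⟩, fun a => ?_⟩
    simp only [encodek, Option.map_some, encode_inj, Option.some.injEq, decide_eq_true_eq]
  choose g hg using this
  have hi : Function.Injective g := by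
    intro D D' h
    apply Subtype.ext
    funext a
    apply propext
    rw [hg, hg, h]
  exact hi.countable

instance : Countable PD := countable_prim

instance : Nonempty PD := ⟨⟨fun _ => True, ⟨inferInstance, by simpa using Primrec.const true⟩⟩⟩

theorem op_use {β : Type} {D : List ℕ × β → Prop} {O : ℕ → ℕ} {b : β} (h : op D O b) :
    ∃ k, ∀ O' : ℕ → ℕ, (∀ n < k, O' n = O n) → op D O' b := by
  obtain ⟨k, hk⟩ := h
  exact ⟨k, fun _ hh => ⟨k, by rwa [pre_congr hh]⟩⟩

/-- numeric version of an element of Cantor space -/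
def bn (h : ℕ → Bool) (n : ℕ) : ℕ := (h n).toNat

theorem lc_pre (O : ℕ → ℕ) (k : ℕ) : IsLocallyConstant (fun h => pre (opair O (bn h)) k) := by
  induction k with
  | zero => exact IsLocallyConstant.const []
  | succ k ih =>
    have h2 : IsLocallyConstant (fun h : ℕ → Bool => h k) :=
      (IsLocallyConstant.iff_continuous _).2 (continuous_apply k)
    have := ih.comp₂ h2 (fun l b => l ++ [Nat.pair (O k) b.toNat])
    convert this using 2 with h
    rw [pre_succ]; rfl

theorem isOpen_op {β : Type} (O : ℕ → ℕ) (D : List ℕ × β → Prop) (b : β) :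
    IsOpen {h | op D (opair O (bn h)) b} := by
  have : {h | op D (opair O (bn h)) b} = ⋃ k, {h | D (pre (opair O (bn h)) k, b)} := by
    ext h; simp [op]
  rw [this]
  exact isOpen_iUnion fun k => lc_pre O k {l | D (l, b)}

/-- all binary decorations of a string -/
def ext (σ : List ℕ) : List (List ℕ) :=
  σ.foldl (fun acc x => acc.flatMap fun ρ => [ρ ++ [Nat.pair x 0], ρ ++ [Nat.pair x 1]]) [[]]

theorem ext_prim : Primrec ext := by
  unfold ext
  refine Primrec.list_foldl (h := fun (_ : List ℕ) (p : List (List ℕ) × ℕ) =>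
    p.1.flatMap fun ρ => [ρ ++ [Nat.pair p.2 0], ρ ++ [Nat.pair p.2 1]])
    Primrec.id (Primrec.const [[]]) ?_
  apply Primrec.list_flatMap (Primrec.fst.comp Primrec.snd)
  have e : ∀ c : ℕ, Primrec fun q : (List ℕ × List (List ℕ) × ℕ) × List ℕ =>
      q.2 ++ [Nat.pair q.1.2.2 c] := fun c =>
    Primrec.list_append.comp Primrec.snd (Primrec.list_cons.comp
      (Primrec₂.natPair.comp (Primrec.snd.comp (Primrec.snd.comp Primrec.fst)) (Primrec.const c))
      (Primrec.const []))
  exact Primrec.list_cons.comp (e 0) (Primrec.list_cons.comp (e 1) (Primrec.const []))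

theorem mem_ext (O : ℕ → ℕ) (k : ℕ) (ρ : List ℕ) :
    ρ ∈ ext (pre O k) ↔ ∃ h, ρ = pre (opair O (bn h)) k := by
  induction k generalizing ρ with
  | zero => simp [ext, pre]
  | succ k ih =>
    have e : ext (pre O (k+1)) = (ext (pre O k)).flatMap
        fun ρ => [ρ ++ [Nat.pair (O k) 0], ρ ++ [Nat.pair (O k) 1]] := by
      rw [pre_succ]; simp [ext]
    rw [e, List.mem_flatMap]
    constructor
    · rintro ⟨ρ', h1, h2⟩
      obtain ⟨h, rfl⟩ := (ih _).1 h1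
      have key : ∀ b : Bool, pre (opair O (bn (Function.update h k b))) (k+1) =
          pre (opair O (bn h)) k ++ [Nat.pair (O k) b.toNat] := by
        intro b
        rw [pre_succ]
        congr 1
        · apply pre_congr
          intro n hn
          simp [opair, bn, Function.update_of_ne (show n ≠ k by omega)]
        · simp [opair, bn]
      simp only [List.mem_cons, List.not_mem_nil, or_false] at h2
      rcases h2 with rfl | rfl
      · exact ⟨_, (key false).symm⟩
      · exact ⟨_, (key true).symm⟩
    · rintro ⟨h, rfl⟩
      refine ⟨_, (ih _).2 ⟨h, rfl⟩, ?_⟩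
      rw [pre_succ]
      cases hh : h k <;> simp [opair, bn, hh]

theorem Sig.allh {ι α : Type} [Primcodable α] {O : ι → ℕ → ℕ} {S : ι → (ℕ → Bool) → α → Prop}
    (h : Sig (fun ih : ι × (ℕ → Bool) => RRT.opair (O ih.1) (bn ih.2)) (fun ih a => S ih.1 ih.2 a)) :
    Sig O (fun i a => ∀ h, S i h a) := by
  obtain ⟨D, hD, h, m⟩ := h.mono
  refine ⟨fun p => ∀ ρ ∈ ext p.1, D (ρ, p.2), ?_, fun i a => ?_⟩
  · have : PrimrecRel fun (ρ : List ℕ) (p : List ℕ × α) => D (ρ, p.2) :=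
      hD.comp (f := fun q : List ℕ × List ℕ × α => (q.1, q.2.2))
        (Primrec.fst.pair (Primrec.snd.comp Primrec.snd))
    exact this.forall_mem_list.comp (ext_prim.comp Primrec.fst) Primrec.id
  · constructor
    · intro hS
      have := isCompact_univ.elim_directed_cover
        (fun k : ℕ => {h : ℕ → Bool | D (pre (RRT.opair (O i) (bn h)) k, a)})
        (fun k => lc_pre (O i) k {l | D (l, a)})
        (fun g _ => by simpa using (h (i, g) a).1 (hS g))
        (directed_of_isDirected_le fun j k hjk g hg => m _ _ _ _ hjk hg)
      obtain ⟨k, hk⟩ := this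
      refine ⟨k, fun ρ hρ => ?_⟩
      obtain ⟨g, rfl⟩ := (mem_ext _ _ _).1 hρ
      exact hk (Set.mem_univ g)
    · rintro ⟨k, hk⟩ g
      exact (h (i, g) a).2 ⟨k, hk _ ((mem_ext _ _ _).2 ⟨g, rfl⟩)⟩

theorem basis_step {w O : ℕ → ℕ} (hO : Av w O) {T : (ℕ → Bool) → Prop}
    (hT : Sig (fun h => opair O (bn h)) (fun h (_ : Unit) => T h)) (hn : ∃ h, ¬ T h) (D : PD) :
    ∃ T' : (ℕ → Bool) → Prop, Sig (fun h => opair O (bn h)) (fun h (_ : Unit) => T' h) ∧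
      (∃ h, ¬ T' h) ∧ (∀ h, T h → T' h) ∧ ∀ h, ¬ T' h → Req w D (opair O (bn h)) := by
  have hS : Sg O (fun p : ℕ × ℕ => ∀ h, T h ∨ op D.1 (opair O (bn h)) p) := by
    apply Sig.allh (S := fun (_ : Unit) h p => T h ∨ op D.1 (opair O (bn h)) p)
    apply Sig.or
    · exact (hT.comp (f := fun p : ℕ × ℕ => ()) (Primrec.const ())).reindex
        (fun ih : Unit × (ℕ → Bool) => ih.2)
    · exact ⟨D.1, D.2, fun i a => Iff.rfl⟩
  obtain ⟨n, ⟨i, hi, h⟩ | h⟩ := hO.dich hS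
  · refine ⟨T, hT, hn, fun _ h => h, fun g hg => ⟨n, Or.inl ⟨i, hi, (h g).resolve_left hg⟩⟩⟩
  · push Not at h
    refine ⟨fun g => T g ∨ op D.1 (opair O (bn g)) (n, w n), ?_, ?_, fun g => Or.inl, ?_⟩
    · apply hT.or
      have : Sig (fun h => opair O (bn h)) (fun g (p : ℕ × ℕ) => op D.1 (opair O (bn g)) p) :=
        ⟨D.1, D.2, fun i a => Iff.rfl⟩
      exact this.comp (f := fun _ : Unit => (n, w n)) (Primrec.const _)
    · obtain ⟨g, hg⟩ := h
      exact ⟨g, by tauto⟩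
    · intro g hg
      exact ⟨n, Or.inr fun h => hg (Or.inr h)⟩

theorem basis {w O : ℕ → ℕ} (hO : Av w O) {T : (ℕ → Bool) → Prop}
    (hT : Sig (fun h => opair O (bn h)) (fun h (_ : Unit) => T h)) (hn : ∃ h, ¬ T h) :
    ∃ h, ¬ T h ∧ Av w (opair O (bn h)) := by
  obtain ⟨e, he⟩ := exists_surjective_nat PD
  let Q := {T : (ℕ → Bool) → Prop // Sig (fun h => opair O (bn h)) (fun h (_ : Unit) => T h) ∧
    ∃ h, ¬ T h}
  have step : ∀ (D : PD) (T : Q), ∃ T' : Q, (∀ h, T.1 h → T'.1 h) ∧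
      ∀ h, ¬ T'.1 h → Req w D (opair O (bn h)) := by
    rintro D ⟨T, h1, h2⟩
    obtain ⟨T', a, b, c, d⟩ := basis_step hO h1 h2 D
    exact ⟨⟨T', a, b⟩, c, d⟩
  choose st hst using step
  let seq : ℕ → Q := fun k => Nat.rec ⟨T, hT, hn⟩ (fun k q => st (e k) q) k
  have hcl : ∀ q : Q, IsClosed {h | ¬ q.1 h} := by
    rintro ⟨T, ⟨D, hD, h1⟩, h2⟩
    have := isOpen_op O D ()
    rw [← isClosed_compl_iff] at this
    convert this using 1
    ext h
    simp [h1 h (), op]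
  have hne : (⋂ k, {h | ¬ (seq k).1 h}).Nonempty := by
    apply IsCompact.nonempty_iInter_of_sequence_nonempty_isCompact_isClosed
    · intro k h hh ht
      exact hh ((hst (e k) (seq k)).1 h ht)
    · intro k; exact (seq k).2.2
    · exact (hcl _).isCompact
    · exact fun k => hcl _
  obtain ⟨h, hh⟩ := hne
  simp only [Set.mem_iInter, Set.mem_ofPred_eq] at hh
  refine ⟨h, hh 0, Av.of_req fun D => ?_⟩
  obtain ⟨k, rfl⟩ := he D
  exact (hst (e k) (seq k)).2 h (hh (k+1))

end RRT

namespace RRT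
open Encodable Filter

/-- the set of elements of a list -/
def ls (l : List ℕ) : Set ℕ := {x | x ∈ l}

@[simp] theorem mem_ls {l : List ℕ} {x : ℕ} : x ∈ ls l ↔ x ∈ l := Iff.rfl

theorem ls_append (l l' : List ℕ) : ls (l ++ l') = ls l ∪ ls l' := by ext; simp [ls]

theorem chi_one {X : Set ℕ} {x : ℕ} : chi X x = 1 ↔ x ∈ X := by
  classical
  by_cases h : x ∈ X <;> simp [chi, h]

theorem chi_zero {X : Set ℕ} {x : ℕ} : chi X x = 0 ↔ x ∉ X := by
  classical
  by_cases h : x ∈ X <;> simp [chi, h]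

theorem chi_of_mem {X : Set ℕ} {x : ℕ} (h : x ∈ X) : chi X x = 1 := chi_one.2 h
theorem chi_of_notMem {X : Set ℕ} {x : ℕ} (h : x ∉ X) : chi X x = 0 := chi_zero.2 h

theorem chi_congr {X Y : Set ℕ} {x : ℕ} (h : x ∈ X ↔ x ∈ Y) : chi X x = chi Y x := by
  by_cases hx : x ∈ X
  · rw [chi_of_mem hx, chi_of_mem (h.1 hx)]
  · rw [chi_of_notMem hx, chi_of_notMem (fun hy => hx (h.2 hy))]

section
variable {ι α : Type} [Primcodable α] {O : ι → ℕ → ℕ}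

theorem Sig.memX {X : ι → Set ℕ} (h : LeF (fun i => chi (X i)) O) {f : α → ℕ} (hf : Primrec f) :
    Sig O (fun i a => f a ∈ X i) :=
  (h.comp (f := fun a => (f a, 1)) (hf.pair (Primrec.const 1))).of_eq fun _ _ => chi_one

theorem Sig.notMemX {X : ι → Set ℕ} (h : LeF (fun i => chi (X i)) O) {f : α → ℕ} (hf : Primrec f) :
    Sig O (fun i a => f a ∉ X i) :=
  (h.comp (f := fun a => (f a, 0)) (hf.pair (Primrec.const 0))).of_eq fun _ _ => chi_zero

theorem Sig.memall {X : ι → Set ℕ} (h : LeF (fun i => chi (X i)) O) {f : α → List ℕ}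
    (hf : Primrec f) : Sig O (fun i a => ∀ x ∈ f a, x ∈ X i) :=
  Sig.ball (S := fun i (_ : α) x => x ∈ X i) (Sig.memX h Primrec.snd) hf

theorem Sig.chiGraph {Y : ι → α → Set ℕ} (h1 : Sig O (fun i (p : α × ℕ) => p.2 ∈ Y i p.1))
    (h2 : Sig O (fun i (p : α × ℕ) => p.2 ∉ Y i p.1)) :
    Sig O (fun i (p : α × ℕ × ℕ) => chi (Y i p.1) p.2.1 = p.2.2) := by
  have e : Primrec (fun p : α × ℕ × ℕ => (p.1, p.2.1)) :=
    Primrec.fst.pair (Primrec.fst.comp Primrec.snd)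
  have c : ∀ c : ℕ, PrimrecPred (fun p : α × ℕ × ℕ => p.2.2 = c) := fun c =>
    Primrec.eq.comp (Primrec.snd.comp Primrec.snd) (Primrec.const c)
  refine (((h1.comp e).and (Sig.prim (c 1))).or ((h2.comp e).and (Sig.prim (c 0)))).of_eq
    fun i p => ?_
  by_cases h : p.2.1 ∈ Y i p.1
  · simp [h, chi_of_mem h, eq_comm]
  · simp [h, chi_of_notMem h, eq_comm]

theorem LeF.chiOf {Y : ι → Set ℕ} (h1 : Sig O (fun i (x : ℕ) => x ∈ Y i))
    (h2 : Sig O (fun i (x : ℕ) => x ∉ Y i)) : LeF (fun i => chi (Y i)) O := by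
  have := Sig.chiGraph (α := Unit) (Y := fun i _ => Y i) (h1.comp (f := fun p : Unit × ℕ => p.2) Primrec.snd)
    (h2.comp (f := fun p : Unit × ℕ => p.2) Primrec.snd)
  exact this.comp (f := fun p : ℕ × ℕ => ((), p)) ((Primrec.const ()).pair Primrec.id)

theorem prim_mem_list : PrimrecRel (fun (x : ℕ) (l : List ℕ) => x ∈ l) := by
  have : PrimrecRel (fun (l : List ℕ) (x : ℕ) => ∃ y ∈ l, y = x) :=
    (Primrec.eq (α := ℕ)).exists_mem_list
  refine PrimrecPred.of_eq (this.comp Primrec.snd Primrec.fst) fun p => ?_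
  simp

theorem Sig.opE {D : PD} {Z : ι → ℕ → ℕ} (hZ : LeF Z O) {f : α → List ℕ} (hf : Primrec f)
    {g : α → ℕ × ℕ} (hg : Primrec g) :
    Sig O (fun i a => RRT.op D.1 (RRT.opair (Z i) (chi (ls (f a)))) (g a)) := by
  refine Sig.op D.2 (g := fun i a => RRT.opair (Z i) (chi (ls (f a)))) ?_ hg
  apply Sig.opair (A := fun i _ => Z i) (B := fun i a => chi (ls (f a)))
  · exact Sig.comp hZ (f := fun p : α × ℕ × ℕ => p.2) Primrec.snd
  · have : PrimrecPred (fun p : α × ℕ => p.2 ∈ f p.1) :=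
      prim_mem_list.comp Primrec.snd (hf.comp Primrec.fst)
    exact Sig.chiGraph (Y := fun i a => ls (f a)) (Sig.prim this) (Sig.prim this.not)

end

/-! ### Forcing -/

theorem force_pos {β : Type} {D : List ℕ × β → Prop} {Z : ℕ → ℕ} {F : List ℕ} {b : β}
    (h : op D (opair Z (chi (ls F))) b) :
    ∃ k, ∀ G : Set ℕ, ls F ⊆ G → (∀ x ∈ G, x ∈ F ∨ k ≤ x) → op D (opair Z (chi G)) b := by
  obtain ⟨k, hk⟩ := op_use h
  refine ⟨k, fun G h1 h2 => hk _ fun n hn => ?_⟩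
  simp only [opair]
  congr 1
  apply chi_congr
  constructor
  · intro h; rcases h2 n h with h | h
    · exact h
    · omega
  · exact fun h => h1 h

theorem force_neg {β : Type} {D : List ℕ × β → Prop} {Z : ℕ → ℕ} {F : List ℕ} {b : β}
    {X G : Set ℕ} (h : op D (opair Z (chi G)) b) (hF : ls F ⊆ G) (hG : G ⊆ ls F ∪ X) :
    ∃ E : List ℕ, (∀ x ∈ E, x ∈ X ∧ x ∈ G) ∧ op D (opair Z (chi (ls (E ++ F)))) b := by
  classical
  obtain ⟨k, hk⟩ := op_use h
  refine ⟨(List.range k).filter (fun x => x ∈ X ∧ x ∈ G), ?_, ?_⟩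
  · intro x hx
    simp only [List.mem_filter, decide_eq_true_eq] at hx
    exact hx.2
  · apply hk
    intro n hn
    simp only [opair]
    congr 1
    apply chi_congr
    simp only [mem_ls, List.mem_append, List.mem_filter, List.mem_range, decide_eq_true_eq]
    constructor
    · rintro (h | h)
      · exact h.2.2
      · exact hF h
    · intro h
      rcases hG h with h' | h'
      · exact Or.inr h'
      · exact Or.inl ⟨hn, h', h⟩

theorem GEN {J : Type} [Countable J] [Nonempty J] (C : List ℕ → Set ℕ → Prop)
    (P : J → List ℕ → Set ℕ → Prop)
    (hP : ∀ j F X, C F X → ∃ F' X', C F' X' ∧ P j F' X' ∧ F ⊆ F' ∧ ls F' ⊆ ls F ∪ X ∧ X' ⊆ X)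
    (F0 : List ℕ) (X0 : Set ℕ) (h0 : C F0 X0) :
    ∃ G : Set ℕ, ls F0 ⊆ G ∧ G ⊆ ls F0 ∪ X0 ∧
      (∀ E : List ℕ, ls E ⊆ G → ∃ F X, C F X ∧ E ⊆ F ∧ ls F ⊆ G) ∧
      ∀ j, ∃ F X, C F X ∧ P j F X ∧ ls F ⊆ G ∧ G ⊆ ls F ∪ X := by
  obtain ⟨e, he⟩ := exists_surjective_nat J
  let Q := {q : List ℕ × Set ℕ // C q.1 q.2}
  have step : ∀ (j : J) (q : Q), ∃ q' : Q, P j q'.1.1 q'.1.2 ∧ q.1.1 ⊆ q'.1.1 ∧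
      ls q'.1.1 ⊆ ls q.1.1 ∪ q.1.2 ∧ q'.1.2 ⊆ q.1.2 := by
    rintro j ⟨⟨F, X⟩, h⟩
    obtain ⟨F', X', a, b⟩ := hP j F X h
    exact ⟨⟨⟨F', X'⟩, a⟩, b⟩
  choose st hst using step
  let seq : ℕ → Q := fun k => Nat.rec ⟨(F0, X0), h0⟩ (fun k q => st (e k) q) k
  have hs : ∀ k, P (e k) (seq (k+1)).1.1 (seq (k+1)).1.2 ∧ (seq k).1.1 ⊆ (seq (k+1)).1.1 ∧
      ls (seq (k+1)).1.1 ⊆ ls (seq k).1.1 ∪ (seq k).1.2 ∧ (seq (k+1)).1.2 ⊆ (seq k).1.2 :=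
    fun k => hst (e k) (seq k)
  have mF : ∀ j k, j ≤ k → (seq j).1.1 ⊆ (seq k).1.1 := by
    intro j k h
    induction h with
    | refl => exact fun _ h => h
    | step _ ih => exact fun _ h => (hs _).2.1 (ih h)
  have mX : ∀ j k, j ≤ k → (seq k).1.2 ⊆ (seq j).1.2 := by
    intro j k h
    induction h with
    | refl => exact fun _ h => h
    | step _ ih => exact fun _ h => ih ((hs _).2.2.2 h)
  have mG : ∀ j k, ls (seq k).1.1 ⊆ ls (seq j).1.1 ∪ (seq j).1.2 := by
    intro j k
    rcases le_total j k with h | h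
    · induction h with
      | refl => exact fun _ h => Or.inl h
      | step h' ih =>
        intro x hx
        rcases (hs _).2.2.1 hx with hx | hx
        · exact ih hx
        · exact Or.inr (mX _ _ h' hx)
    · exact fun x hx => Or.inl (mF _ _ h hx)
  let G : Set ℕ := ⋃ k, ls (seq k).1.1
  have hG1 : ∀ k, ls (seq k).1.1 ⊆ G := fun k => Set.subset_iUnion (fun k => ls (seq k).1.1) k
  have hG2 : ∀ k, G ⊆ ls (seq k).1.1 ∪ (seq k).1.2 := fun k => Set.iUnion_subset (mG k)
  refine ⟨G, hG1 0, hG2 0, ?_, ?_⟩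
  · intro E hE
    have : ∃ k, E ⊆ (seq k).1.1 := by
      induction E with
      | nil => exact ⟨0, by simp⟩
      | cons x E ih =>
        obtain ⟨k, hk⟩ := ih (fun y hy => hE (List.mem_cons_of_mem _ hy))
        obtain ⟨k', hk'⟩ := Set.mem_iUnion.1 (hE (List.mem_cons_self : x ∈ x :: E))
        refine ⟨max k k', fun y hy => ?_⟩
        rcases List.mem_cons.1 hy with rfl | hy
        · exact mF _ _ (le_max_right _ _) hk'
        · exact mF _ _ (le_max_left _ _) (hk hy)
    obtain ⟨k, hk⟩ := this
    exact ⟨_, _, (seq k).2, hk, hG1 k⟩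
  · intro j
    obtain ⟨k, rfl⟩ := he j
    exact ⟨_, _, (seq (k+1)).2, (hs k).1, hG1 (k+1), hG2 (k+1)⟩

/-- shorthand: `Z ⊕ X` does not compute `w` -/
abbrev AvX (w Z : ℕ → ℕ) (X : Set ℕ) : Prop := Av w (opair Z (chi X))

theorem AvX.of_Le {w Z : ℕ → ℕ} {X : Set ℕ} {O : ℕ → ℕ} (h : Av w O) (hZ : Le Z O)
    (hX : Le (chi X) O) : AvX w Z X := h.anti (hZ.pair hX)

theorem Le.inter {X Y : Set ℕ} {O : ℕ → ℕ} (h : Le (chi X) O) (h' : Le (chi Y) O) :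
    Le (chi (X ∩ Y)) O := by
  apply LeF.chiOf (Y := fun _ : Unit => X ∩ Y)
  · exact (Sig.memX (X := fun _ => X) h Primrec.id).and (Sig.memX (X := fun _ => Y) h' Primrec.id)
  · refine ((Sig.notMemX (X := fun _ => X) h Primrec.id).or
      (Sig.notMemX (X := fun _ => Y) h' Primrec.id)).of_eq fun i x => ?_
    simp only [Set.mem_inter_iff, id]; tauto

theorem Le.compl {X : Set ℕ} {O : ℕ → ℕ} (h : Le (chi X) O) : Le (chi Xᶜ) O := by
  apply LeF.chiOf (Y := fun _ : Unit => Xᶜ)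
  · exact (Sig.notMemX (X := fun _ => X) h Primrec.id)
  · exact (Sig.memX (X := fun _ => X) h Primrec.id).of_eq fun i x => by simp

theorem Le.Ici (k : ℕ) {O : ℕ → ℕ} : Le (chi (Set.Ici k)) O := by
  have : PrimrecPred (fun x : ℕ => k ≤ x) := Primrec.nat_le.comp (Primrec.const k) Primrec.id
  exact LeF.chiOf (Y := fun _ : Unit => Set.Ici k) (Sig.prim this) (Sig.prim this.not)

theorem Le.bool (h : ℕ → Bool) {O : ℕ → ℕ} : Le (chi {x | h x = true}) (opair O (bn h)) := by
  have key : ∀ c : ℕ, Sg (opair O (bn h)) (fun x : ℕ => bn h x = c) := fun c =>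
    Sig.comp (LeF.right (A := fun _ : Unit => O) (B := fun _ => bn h))
      (f := fun x : ℕ => (x, c)) (Primrec.id.pair (Primrec.const c))
  refine LeF.chiOf (Y := fun _ : Unit => {x | h x = true}) ((key 1).of_eq fun _ x => ?_)
    ((key 0).of_eq fun _ x => ?_) <;> cases hx : h x <;> simp [bn, hx]

theorem Le.left' {A B : ℕ → ℕ} : Le A (opair A B) := LeF.left (A := fun _ => A) (B := fun _ => B)
theorem Le.right' {A B : ℕ → ℕ} : Le B (opair A B) := LeF.right (A := fun _ => A) (B := fun _ => B)

theorem AvX.inter {w Z : ℕ → ℕ} {X Y : Set ℕ} (h : AvX w Z X) (hY : Le (chi Y) (opair Z (chi X))) :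
    AvX w Z (X ∩ Y) := AvX.of_Le h Le.left' (Le.right'.inter hY)

theorem AvX.tail {w Z : ℕ → ℕ} {X : Set ℕ} (h : AvX w Z X) (k : ℕ) : AvX w Z (X ∩ Set.Ici k) :=
  h.inter (Le.Ici k)

theorem inf_tail {X : Set ℕ} (h : X.Infinite) (k : ℕ) : (X ∩ Set.Ici k).Infinite := by
  apply Set.infinite_of_forall_exists_gt
  intro a
  obtain ⟨b, hb, h⟩ := h.exists_gt (max a k)
  exact ⟨b, ⟨hb, by simp; omega⟩, by omega⟩

theorem inf_split {X Y : Set ℕ} (h : X.Infinite) : (X ∩ Y).Infinite ∨ (X ∩ Yᶜ).Infinite := by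
  by_contra hc
  push Not at hc
  apply h
  rw [← Set.inter_union_compl X Y]
  exact hc.1.union hc.2

/-- the filter of almost all elements of `X` -/
abbrev fl (X : Set ℕ) : Filter ℕ := atTop ⊓ 𝓟 X

theorem ev_iff {X : Set ℕ} {p : ℕ → Prop} :
    (∀ᶠ y in fl X, p y) ↔ ∃ k, ∀ y ∈ X, k ≤ y → p y := by
  rw [eventually_inf_principal, eventually_atTop]
  exact exists_congr fun k => ⟨fun h y a b => h y b a, fun h y a b => h y b a⟩

theorem fl_neBot {X : Set ℕ} (h : X.Infinite) : (fl X).NeBot := by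
  rw [← frequently_true_iff_neBot, Filter.Frequently, ev_iff]
  rintro ⟨k, hk⟩
  obtain ⟨b, hb, hkb⟩ := h.exists_gt k
  exact hk b hb hkb.le trivial

theorem fl_mono {X Y : Set ℕ} (h : X ⊆ Y) : fl X ≤ fl Y :=
  inf_le_inf_left _ (principal_mono.2 h)

theorem MATHIAS {w Z : ℕ → ℕ} {X : Set ℕ} (hX : X.Infinite) (hA : AvX w Z X)
    {K : List ℕ → Prop} (hK : Sg Z K) (her : ∀ l l', l' ⊆ l → K l → K l') (hnil : K [])
    (hext : ∀ l, ls l ⊆ X → K l → ∀ᶠ y in fl X, K (y :: l))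
    {J : Type} [Countable J] (R : J → Set ℕ) (hR : ∀ j, Le (chi (R j)) Z) :
    ∃ G ⊆ X, G.Infinite ∧ AvX w Z G ∧ (∀ l, ls l ⊆ G → K l) ∧
      ∀ j, (∀ᶠ y in fl G, y ∈ R j) ∨ (∀ᶠ y in fl G, y ∉ R j) := by
  let C : List ℕ → Set ℕ → Prop := fun F Y => Y.Infinite ∧ AvX w Z Y ∧ Y ⊆ X ∧ ls F ⊆ X ∧ K F
  let P : PD ⊕ ℕ ⊕ J → List ℕ → Set ℕ → Prop := fun j F Y => match j with
    | .inl D => ∀ G, ls F ⊆ G → G ⊆ ls F ∪ Y → (∀ l, ls l ⊆ G → K l) → Req w D (opair Z (chi G))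
    | .inr (.inl n) => ∃ x ∈ F, n ≤ x
    | .inr (.inr j) => Y ⊆ R j ∨ Y ⊆ (R j)ᶜ
  obtain ⟨G, h1, h2, h3, h4⟩ := GEN C P (by
    rintro (D | n | j) F Y ⟨hY, hAY, hYX, hFX, hKF⟩
    · have hS : Sg (opair Z (chi Y)) (fun p : ℕ × ℕ => ∃ E : List ℕ, (∀ x ∈ E, x ∈ Y) ∧
          K (E ++ F) ∧ op D.1 (opair Z (chi (ls (E ++ F)))) p) := by
        apply Sig.ex (S := fun (_ : Unit) (p : ℕ × ℕ) (E : List ℕ) => (∀ x ∈ E, x ∈ Y) ∧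
          K (E ++ F) ∧ op D.1 (opair Z (chi (ls (E ++ F)))) p)
        have e : Primrec (fun q : (ℕ × ℕ) × List ℕ => q.2 ++ F) :=
          Primrec.list_append.comp Primrec.snd (Primrec.const F)
        refine (Sig.memall (X := fun _ => Y) Le.right' Primrec.snd).and (Sig.and ?_ ?_)
        · exact Sig.comp (Le.left'.sig hK) e
        · exact Sig.opE (Z := fun _ => Z) Le.left' e Primrec.fst
      obtain ⟨n, ⟨i, hi, E, hE, hKE, hop⟩ | h⟩ := hAY.dich hS
      · obtain ⟨k, hk⟩ := force_pos hop
        refine ⟨E ++ F, Y ∩ Set.Ici k, ⟨inf_tail hY k, hAY.tail k, fun x hx => hYX hx.1, ?_, hKE⟩,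
          ?_, by simp, ?_, Set.inter_subset_left⟩
        · rw [ls_append]; exact Set.union_subset (fun x hx => hYX (hE x hx)) hFX
        · intro G hG1 hG2 _
          exact ⟨n, Or.inl ⟨i, hi, hk G hG1 fun x hx => (hG2 hx).imp id fun h => h.2⟩⟩
        · rw [ls_append, Set.union_comm]
          exact Set.union_subset_union_right _ (fun x hx => hE x hx)
      · refine ⟨F, Y, ⟨hY, hAY, hYX, hFX, hKF⟩, ?_, fun _ h => h, Set.subset_union_left, fun _ h => h⟩
        intro G hG1 hG2 hGK
        refine ⟨n, Or.inr fun hop => h ?_⟩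
        obtain ⟨E, hE, hop⟩ := force_neg hop hG1 hG2
        refine ⟨E, fun x hx => (hE x hx).1, hGK _ ?_, hop⟩
        rw [ls_append]; exact Set.union_subset (fun x hx => (hE x hx).2) hG1
    · obtain ⟨k, hk⟩ := ev_iff.1 (hext F hFX hKF)
      obtain ⟨y, hy, hky⟩ := hY.exists_gt (max k n)
      refine ⟨y :: F, Y, ⟨hY, hAY, hYX, ?_, hk y (hYX hy) (by omega)⟩, ⟨y, by simp, by omega⟩,
        by simp, ?_, fun _ h => h⟩
      · intro x hx
        rcases List.mem_cons.1 hx with rfl | hx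
        · exact hYX hy
        · exact hFX hx
      · intro x hx
        rcases List.mem_cons.1 hx with rfl | hx
        · exact Or.inr hy
        · exact Or.inl hx
    · have hRY : Le (chi (R j)) (opair Z (chi Y)) := (hR j).trans Le.left'
      rcases inf_split (Y := R j) hY with h | h
      · exact ⟨F, _, ⟨h, hAY.inter hRY, fun x hx => hYX hx.1, hFX, hKF⟩,
          Or.inl Set.inter_subset_right, fun _ h => h, Set.subset_union_left, Set.inter_subset_left⟩
      · exact ⟨F, _, ⟨h, hAY.inter hRY.compl, fun x hx => hYX hx.1, hFX, hKF⟩,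
          Or.inr Set.inter_subset_right, fun _ h => h, Set.subset_union_left, Set.inter_subset_left⟩)
    [] X ⟨hX, hA, fun _ h => h, by intro x hx; simp at hx, hnil⟩
  have hGX : G ⊆ X := fun x hx => (h2 hx).resolve_left (by simp)
  have hGK : ∀ l, ls l ⊆ G → K l := by
    intro l hl
    obtain ⟨F, Y, hC, hlF, _⟩ := h3 l hl
    exact her _ _ hlF hC.2.2.2.2
  refine ⟨G, hGX, ?_, ?_, hGK, ?_⟩
  · apply Set.infinite_of_forall_exists_gt
    intro n
    obtain ⟨F, Y, _, ⟨x, hx, hn⟩, hF, _⟩ := h4 (.inr (.inl (n+1)))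
    exact ⟨x, hF hx, hn⟩
  · apply Av.of_req
    intro D
    obtain ⟨F, Y, _, h, hF, hG⟩ := h4 (.inl D)
    exact h G hF hG hGK
  · intro j
    obtain ⟨F, Y, _, h, hF, hG⟩ := h4 (.inr (.inr j))
    have hb : ∀ᶠ y in fl G, y ∈ Y := by
      rw [ev_iff]
      refine ⟨F.sum + 1, fun y hy hs => (hG hy).resolve_left fun hyF => ?_⟩
      have := List.le_sum_of_mem (show y ∈ F from hyF)
      omega
    exact h.imp (fun h => hb.mono fun y hy => h hy) (fun h => hb.mono fun y hy => h hy)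

end RRT

namespace RRT
open Encodable Filter

theorem LeF.cst {ι : Type} {A B : ℕ → ℕ} (h : Le A B) : LeF (fun _ : ι => A) (fun _ : ι => B) :=
  h.reindex (fun _ : ι => ())

theorem LeF.hX {ι : Type} {O : ι → ℕ → ℕ} {h : ι → ℕ → Bool} (hh : LeF (fun i => bn (h i)) O) :
    LeF (fun i => chi {x | h i x = true}) O := by
  have key : ∀ c : ℕ, Sig O (fun i (x : ℕ) => bn (h i) x = c) := fun c =>
    Sig.comp hh (f := fun x : ℕ => (x, c)) (Primrec.id.pair (Primrec.const c))
  refine LeF.chiOf (Y := fun i => {x | h i x = true}) ((key 1).of_eq fun i x => ?_)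
    ((key 0).of_eq fun i x => ?_) <;> cases hx : h i x <;> simp [bn, hx]

theorem LeF.interX {ι : Type} {O : ι → ℕ → ℕ} {X Y : ι → Set ℕ} (h : LeF (fun i => chi (X i)) O)
    (h' : LeF (fun i => chi (Y i)) O) : LeF (fun i => chi (X i ∩ Y i)) O := by
  apply LeF.chiOf (Y := fun i => X i ∩ Y i)
  · exact (Sig.memX h Primrec.id).and (Sig.memX h' Primrec.id)
  · refine ((Sig.notMemX h Primrec.id).or (Sig.notMemX h' Primrec.id)).of_eq fun i x => ?_
    simp only [Set.mem_inter_iff, id]; tauto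

theorem LeF.complX {ι : Type} {O : ι → ℕ → ℕ} {X : ι → Set ℕ} (h : LeF (fun i => chi (X i)) O) :
    LeF (fun i => chi (X i)ᶜ) O := by
  apply LeF.chiOf (Y := fun i => (X i)ᶜ)
  · exact (Sig.notMemX h Primrec.id)
  · exact (Sig.memX h Primrec.id).of_eq fun i x => by simp

theorem Sig.exE {ι : Type} {O : ι → ℕ → ℕ} {Z : ι → ℕ → ℕ} {X : ι → Set ℕ} (hZ : LeF Z O)
    (hX : LeF (fun i => chi (X i)) O) (D : PD) (F : List ℕ) :
    Sig O (fun i (p : ℕ × ℕ) => ∃ E : List ℕ, (∀ x ∈ E, x ∈ X i) ∧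
      RRT.op D.1 (RRT.opair (Z i) (chi (ls (E ++ F)))) p) := by
  apply Sig.ex (S := fun i (p : ℕ × ℕ) (E : List ℕ) => (∀ x ∈ E, x ∈ X i) ∧
    RRT.op D.1 (RRT.opair (Z i) (chi (ls (E ++ F)))) p)
  have e : Primrec (fun q : (ℕ × ℕ) × List ℕ => q.2 ++ F) :=
    Primrec.list_append.comp Primrec.snd (Primrec.const F)
  exact (Sig.memall hX Primrec.snd).and (Sig.opE hZ e Primrec.fst)

theorem rt1_step {w Z : ℕ → ℕ} {A : Set ℕ} {D0 D1 : PD} {F : List ℕ} {Y : Set ℕ}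
    (hY : Y.Infinite) (hAY : AvX w Z Y) :
    ∃ (F' : List ℕ) (Y' : Set ℕ), Y'.Infinite ∧ AvX w Z Y' ∧ (∀ G, ls F' ⊆ G → G ⊆ ls F' ∪ Y' →
      Req w D0 (opair Z (chi (G ∩ A))) ∨ Req w D1 (opair Z (chi (G ∩ Aᶜ)))) ∧
      F ⊆ F' ∧ ls F' ⊆ ls F ∪ Y ∧ Y' ⊆ Y := by
  classical
  let FA := F.filter (fun x => x ∈ A)
  let FB := F.filter (fun x => x ∉ A)
  have hFA : ∀ x, x ∈ FA ↔ x ∈ F ∧ x ∈ A := by simp [FA]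
  have hFB : ∀ x, x ∈ FB ↔ x ∈ F ∧ x ∉ A := by simp [FB]
  let U : (ℕ → Bool) → ℕ × ℕ → Prop := fun h p =>
    (∃ E : List ℕ, (∀ x ∈ E, x ∈ Y ∩ {x | h x = true}) ∧ op D0.1 (opair Z (chi (ls (E ++ FA)))) p) ∨
    (∃ E : List ℕ, (∀ x ∈ E, x ∈ Y ∩ {x | h x = true}ᶜ) ∧ op D1.1 (opair Z (chi (ls (E ++ FB)))) p)
  have hU : Sig (fun h : ℕ → Bool => opair (opair Z (chi Y)) (bn h)) U := by
    have a1 : LeF (fun _ : ℕ → Bool => Z) (fun h : ℕ → Bool => opair (opair Z (chi Y)) (bn h)) :=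
      (LeF.cst Le.left').trans LeF.left
    have a2 : LeF (fun _ : ℕ → Bool => chi Y) (fun h : ℕ → Bool => opair (opair Z (chi Y)) (bn h)) :=
      (LeF.cst Le.right').trans LeF.left
    have a3 : LeF (fun h => chi {x | h x = true}) (fun h : ℕ → Bool => opair (opair Z (chi Y)) (bn h)) :=
      LeF.hX (h := fun h => h) LeF.right
    exact (Sig.exE a1 (LeF.interX a2 a3) D0 FA).or (Sig.exE a1 (LeF.interX a2 a3.complX) D1 FB)
  have hS : Sg (opair Z (chi Y)) (fun p : ℕ × ℕ => ∀ h, U h p) := by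
    apply Sig.allh (S := fun (_ : Unit) h p => U h p)
    exact hU.reindex (fun ih : Unit × (ℕ → Bool) => ih.2)
  have base : ∀ E : List ℕ, (∀ x ∈ E, x ∈ Y) → F ⊆ E ++ F ∧ ls (E ++ F) ⊆ ls F ∪ Y := by
    intro E hE
    refine ⟨by simp, ?_⟩
    rw [ls_append, Set.union_comm]
    exact Set.union_subset_union_right _ (fun x hx => hE x hx)
  obtain ⟨n, ⟨i, hi, h⟩ | h⟩ := hAY.dich hS
  · rcases h (fun x => decide (x ∈ A)) with ⟨E, hE, hop⟩ | ⟨E, hE, hop⟩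
    · obtain ⟨k, hk⟩ := force_pos hop
      simp only [Set.mem_inter_iff, Set.mem_ofPred_eq, decide_eq_true_eq] at hE
      refine ⟨E ++ F, Y ∩ Set.Ici k, inf_tail hY k, hAY.tail k, ?_,
        (base E fun x hx => (hE x hx).1).1, (base E fun x hx => (hE x hx).1).2,
        Set.inter_subset_left⟩
      intro G hG1 hG2
      refine Or.inl ⟨n, Or.inl ⟨i, hi, hk _ ?_ ?_⟩⟩
      · intro x hx
        rcases List.mem_append.1 hx with hx | hx
        · exact ⟨hG1 (List.mem_append_left _ hx), (hE x hx).2⟩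
        · exact ⟨hG1 (List.mem_append_right _ ((hFA x).1 hx).1), ((hFA x).1 hx).2⟩
      · rintro x ⟨hx, hxA⟩
        rcases hG2 hx with hx | hx
        · left
          rcases List.mem_append.1 hx with hx | hx
          · exact List.mem_append_left _ hx
          · exact List.mem_append_right _ ((hFA x).2 ⟨hx, hxA⟩)
        · exact Or.inr hx.2
    · obtain ⟨k, hk⟩ := force_pos hop
      simp only [Set.mem_inter_iff, Set.mem_compl_iff, Set.mem_ofPred_eq, decide_eq_true_eq] at hE
      refine ⟨E ++ F, Y ∩ Set.Ici k, inf_tail hY k, hAY.tail k, ?_,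
        (base E fun x hx => (hE x hx).1).1, (base E fun x hx => (hE x hx).1).2,
        Set.inter_subset_left⟩
      intro G hG1 hG2
      refine Or.inr ⟨n, Or.inl ⟨i, hi, hk _ ?_ ?_⟩⟩
      · intro x hx
        rcases List.mem_append.1 hx with hx | hx
        · exact ⟨hG1 (List.mem_append_left _ hx), (hE x hx).2⟩
        · exact ⟨hG1 (List.mem_append_right _ ((hFB x).1 hx).1), ((hFB x).1 hx).2⟩
      · rintro x ⟨hx, hxA⟩
        rcases hG2 hx with hx | hx
        · left
          rcases List.mem_append.1 hx with hx | hx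
          · exact List.mem_append_left _ hx
          · exact List.mem_append_right _ ((hFB x).2 ⟨hx, hxA⟩)
        · exact Or.inr hx.2
  · push Not at h
    obtain ⟨g, hg, hAg⟩ := basis hAY (T := fun g => U g (n, w n))
      (hU.comp (f := fun _ : Unit => (n, w n)) (Primrec.const _)) h
    have b2 : Le (chi Y) (opair (opair Z (chi Y)) (bn g)) := Le.right'.trans Le.left'
    have b3 : Le (chi {x | g x = true}) (opair (opair Z (chi Y)) (bn g)) := Le.bool g
    simp only [U, not_or] at hg
    rcases inf_split (Y := {x | g x = true}) hY with hi | hi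
    · refine ⟨F, _, hi, AvX.of_Le hAg (Le.left'.trans Le.left') (b2.inter b3), ?_, fun _ h => h,
        Set.subset_union_left, Set.inter_subset_left⟩
      intro G hG1 hG2
      refine Or.inl ⟨n, Or.inr fun hop => hg.1 ?_⟩
      obtain ⟨E, hE, hop⟩ := force_neg (F := FA) (X := Y ∩ {x | g x = true}) hop
        (fun x hx => ⟨hG1 ((hFA x).1 hx).1, ((hFA x).1 hx).2⟩)
        (fun x hx => (hG2 hx.1).imp (fun h => (hFA x).2 ⟨h, hx.2⟩) id)
      exact ⟨E, fun x hx => (hE x hx).1, hop⟩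
    · refine ⟨F, _, hi, AvX.of_Le hAg (Le.left'.trans Le.left') (b2.inter b3.compl), ?_, fun _ h => h,
        Set.subset_union_left, Set.inter_subset_left⟩
      intro G hG1 hG2
      refine Or.inr ⟨n, Or.inr fun hop => hg.2 ?_⟩
      obtain ⟨E, hE, hop⟩ := force_neg (F := FB) (X := Y ∩ {x | g x = true}ᶜ) hop
        (fun x hx => ⟨hG1 ((hFB x).1 hx).1, ((hFB x).1 hx).2⟩)
        (fun x hx => (hG2 hx.1).imp (fun h => (hFB x).2 ⟨h, hx.2⟩) id)
      exact ⟨E, fun x hx => (hE x hx).1, hop⟩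

theorem RT1 {w Z : ℕ → ℕ} {X : Set ℕ} (hX : X.Infinite) (hA : AvX w Z X) (A : Set ℕ) :
    ∃ Y ⊆ X, Y.Infinite ∧ AvX w Z Y ∧ (Y ⊆ A ∨ Y ⊆ Aᶜ) := by
  by_contra hc
  have hc : ∀ Y, Y ⊆ X → Y.Infinite → AvX w Z Y → ¬ (Y ⊆ A ∨ Y ⊆ Aᶜ) :=
    fun Y a b c d => hc ⟨Y, a, b, c, d⟩
  have both : ∀ B, (B = A ∨ B = Aᶜ) → ∀ Y, Y ⊆ X → Y.Infinite → AvX w Z Y → ∀ n, ∃ y ∈ Y, y ∈ B ∧ n ≤ y := by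
    intro B hB Y a b c n
    by_contra hn
    push Not at hn
    refine hc (Y ∩ Set.Ici n) (fun x hx => a hx.1) (inf_tail b n) (c.tail n) ?_
    have : Y ∩ Set.Ici n ⊆ Bᶜ := fun x hx hxB => by
      have := hn x hx.1 hxB
      have h2 : n ≤ x := hx.2
      omega
    rcases hB with rfl | rfl
    · exact Or.inr this
    · left; simpa using this
  let C : List ℕ → Set ℕ → Prop := fun F Y => Y.Infinite ∧ AvX w Z Y ∧ Y ⊆ X
  let P : (PD × PD) ⊕ ℕ → List ℕ → Set ℕ → Prop := fun j F Y => match j with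
    | .inl D => ∀ G, ls F ⊆ G → G ⊆ ls F ∪ Y →
      Req w D.1 (opair Z (chi (G ∩ A))) ∨ Req w D.2 (opair Z (chi (G ∩ Aᶜ)))
    | .inr n => (∃ x ∈ F, x ∈ A ∧ n ≤ x) ∧ (∃ x ∈ F, x ∈ Aᶜ ∧ n ≤ x)
  obtain ⟨G, h1, h2, h3, h4⟩ := GEN C P (by
    rintro (⟨D0, D1⟩ | n) F Y ⟨hY, hAY, hYX⟩
    · obtain ⟨F', Y', a, b, c, d, e, f⟩ := rt1_step (A := A) (D0 := D0) (D1 := D1) (F := F) hY hAY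
      exact ⟨F', Y', ⟨a, b, f.trans hYX⟩, c, d, e, f⟩
    · obtain ⟨a, ha, haA, han⟩ := both A (Or.inl rfl) Y hYX hY hAY n
      obtain ⟨b, hb, hbA, hbn⟩ := both Aᶜ (Or.inr rfl) Y hYX hY hAY n
      refine ⟨a :: b :: F, Y, ⟨hY, hAY, hYX⟩, ⟨⟨a, by simp, haA, han⟩, ⟨b, by simp, hbA, hbn⟩⟩,
        ?_, ?_, fun _ h => h⟩
      · intro x hx; simp [hx]
      · intro x hx
        simp only [mem_ls, List.mem_cons] at hx
        rcases hx with rfl | rfl | hx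
        · exact Or.inr ha
        · exact Or.inr hb
        · exact Or.inl hx)
    [] X ⟨hX, hA, fun _ h => h⟩
  have hGX : G ⊆ X := fun x hx => (h2 hx).resolve_left (by simp)
  have i1 : (G ∩ A).Infinite := by
    apply Set.infinite_of_forall_exists_gt
    intro n
    obtain ⟨F, Y, _, ⟨⟨x, hx, hn⟩, _⟩, hF, _⟩ := h4 (.inr (n+1))
    exact ⟨x, ⟨hF hx, hn.1⟩, hn.2⟩
  have i2 : (G ∩ Aᶜ).Infinite := by
    apply Set.infinite_of_forall_exists_gt
    intro n
    obtain ⟨F, Y, _, ⟨_, ⟨x, hx, hn⟩⟩, hF, _⟩ := h4 (.inr (n+1))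
    exact ⟨x, ⟨hF hx, hn.1⟩, hn.2⟩
  by_cases hd : ∀ D, Req w D (opair Z (chi (G ∩ A)))
  · exact hc _ (fun x hx => hGX hx.1) i1 (Av.of_req hd) (Or.inl Set.inter_subset_right)
  · push Not at hd
    obtain ⟨D0, hD0⟩ := hd
    refine hc _ (fun x hx => hGX hx.1) i2 (Av.of_req fun D1 => ?_) (Or.inr Set.inter_subset_right)
    obtain ⟨F, Y, _, h, hF, hG⟩ := h4 (.inl (D0, D1))
    exact (h G hF hG).resolve_left hD0

end RRT

namespace RRT
open Encodable Filter

/-- strictly decreasing lists -/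
def Desc (l : List ℕ) : Prop := l.Pairwise (· > ·)

/-- partial matchings on the strictly decreasing lists -/
structure IsMat (M : List ℕ → List ℕ → Prop) : Prop where
  supp : ∀ s t, M s t → Desc s ∧ Desc t
  symm : ∀ s t, M s t → M t s
  mat : ∀ s t u, M s t → M s u → s ≠ t → s ≠ u → t = u

/-- `X` is free for `M` on tuples of length `d` -/
def Rb (d : ℕ) (M : List ℕ → List ℕ → Prop) (X : Set ℕ) : Prop :=
  ∀ s t : List ℕ, s.length = d → t.length = d → ls s ⊆ X → ls t ⊆ X → M s t → s = t

theorem Rb.mono {d : ℕ} {M : List ℕ → List ℕ → Prop} {X Y : Set ℕ} (h : Rb d M Y) (hX : X ⊆ Y) :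
    Rb d M X := fun s t a b c e => h s t a b (c.trans hX) (e.trans hX)

/-- all tuples from a list -/
def tuples : ℕ → List ℕ → List (List ℕ)
  | 0, _ => [[]]
  | d + 1, l => l.flatMap fun x => (tuples d l).map fun s => x :: s

theorem mem_tuples {d : ℕ} {l s : List ℕ} : s ∈ tuples d l ↔ s.length = d ∧ ls s ⊆ ls l := by
  induction d generalizing s with
  | zero =>
    simp only [tuples, List.mem_singleton, List.length_eq_zero_iff]
    constructor
    · rintro rfl; exact ⟨rfl, fun x hx => by simp at hx⟩
    · exact fun h => h.1
  | succ d ih =>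
    simp only [tuples, List.mem_flatMap, List.mem_map, ih]
    constructor
    · rintro ⟨x, hx, s, ⟨h1, h2⟩, rfl⟩
      refine ⟨by simp [h1], fun y hy => ?_⟩
      rcases List.mem_cons.1 hy with rfl | hy
      · exact hx
      · exact h2 hy
    · rintro ⟨h1, h2⟩
      obtain _ | ⟨x, s⟩ := s
      · simp at h1
      · exact ⟨x, h2 List.mem_cons_self, s, ⟨by simpa using h1,
          fun y hy => h2 (List.mem_cons_of_mem _ hy)⟩, rfl⟩

theorem tuples_prim (d : ℕ) : Primrec (tuples d) := by
  induction d with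
  | zero => exact Primrec.const [[]]
  | succ d ih =>
    change Primrec fun l : List ℕ => l.flatMap fun x => (tuples d l).map fun s => x :: s
    apply Primrec.list_flatMap Primrec.id
    apply Primrec.list_map (ih.comp Primrec.fst)
    exact Primrec.list_cons.comp (Primrec.snd.comp Primrec.fst) Primrec.snd

section
variable {ι α : Type} [Primcodable α] {O : ι → ℕ → ℕ}

theorem rb_list {d : ℕ} {M : List ℕ → List ℕ → Prop} {l : List ℕ} :
    Rb d M (ls l) ↔ ∀ s ∈ tuples d l, ∀ t ∈ tuples d l, ¬ M s t ∨ s = t := by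
  simp only [mem_tuples]
  constructor
  · intro h s hs t ht
    by_cases hm : M s t
    · exact Or.inr (h s t hs.1 ht.1 hs.2 ht.2 hm)
    · exact Or.inl hm
  · intro h s t a b c e f
    exact (h s ⟨a, c⟩ t ⟨b, e⟩).resolve_left (fun h => h f)

theorem Sig.rb {d : ℕ} {M : ι → List ℕ → List ℕ → Prop}
    (hM : Sig O (fun i (p : List ℕ × List ℕ) => ¬ M i p.1 p.2)) {f : α → List ℕ} (hf : Primrec f) :
    Sig O (fun i a => Rb d (M i) (ls (f a))) := by
  refine Sig.of_eq ?_ fun i a => rb_list.symm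
  apply Sig.ball (S := fun i a s => ∀ t ∈ tuples d (f a), ¬ M i s t ∨ s = t) _ ((tuples_prim d).comp hf)
  apply Sig.ball (S := fun i (p : α × List ℕ) t => ¬ M i p.2 t ∨ p.2 = t) _
    ((tuples_prim d).comp (hf.comp Primrec.fst))
  apply Sig.or
  · exact hM.comp (f := fun q : (α × List ℕ) × List ℕ => (q.1.2, q.2))
      ((Primrec.snd.comp Primrec.fst).pair Primrec.snd)
  · exact Sig.prim (Primrec.eq.comp (Primrec.snd.comp Primrec.fst) Primrec.snd)

theorem Sig.nrb {d : ℕ} {M : ι → List ℕ → List ℕ → Prop}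
    (hM : Sig O (fun i (p : List ℕ × List ℕ) => M i p.1 p.2)) {f : α → List ℕ} (hf : Primrec f) :
    Sig O (fun i a => ¬ Rb d (M i) (ls (f a))) := by
  have : Sig O (fun i a => ∃ p : List ℕ × List ℕ, ((p.1 ∈ tuples d (f a) ∧ p.2 ∈ tuples d (f a)) ∧
      p.1 ≠ p.2) ∧ M i p.1 p.2) := by
    apply Sig.ex (S := fun i a (p : List ℕ × List ℕ) => ((p.1 ∈ tuples d (f a) ∧ p.2 ∈ tuples d (f a)) ∧
      p.1 ≠ p.2) ∧ M i p.1 p.2)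
    apply Sig.and
    · have hm : PrimrecRel (fun (x : List ℕ) (l : List (List ℕ)) => x ∈ l) := by
        have : PrimrecRel (fun (l : List (List ℕ)) (x : List ℕ) => ∃ y ∈ l, y = x) :=
          (Primrec.eq (α := List ℕ)).exists_mem_list
        refine PrimrecPred.of_eq (this.comp Primrec.snd Primrec.fst) fun p => ?_
        simp
      have ht : Primrec (fun q : α × List ℕ × List ℕ => tuples d (f q.1)) :=
        (tuples_prim d).comp (hf.comp Primrec.fst)
      have h1 : Primrec (fun q : α × List ℕ × List ℕ => q.2.1) := Primrec.fst.comp Primrec.snd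
      have h2 : Primrec (fun q : α × List ℕ × List ℕ => q.2.2) := Primrec.snd.comp Primrec.snd
      exact Sig.prim (((hm.comp h1 ht).and (hm.comp h2 ht)).and (Primrec.eq.comp h1 h2).not)
    · exact hM.comp (f := fun q : α × List ℕ × List ℕ => q.2) Primrec.snd
  refine this.of_eq fun i a => ?_
  rw [rb_list]
  push Not
  constructor
  · rintro ⟨⟨s, t⟩, ⟨⟨h1, h2⟩, h3⟩, h4⟩
    exact ⟨s, h1, t, h2, h4, h3⟩
  · rintro ⟨s, h1, t, h2, h4, h3⟩
    exact ⟨⟨s, t⟩, ⟨⟨h1, h2⟩, h3⟩, h4⟩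

end

theorem ev_tuples {𝓕 : Filter ℕ} {d : ℕ} {l : List ℕ} {p : List ℕ → ℕ → Prop}
    (h : ∀ s, s.length = d → ls s ⊆ ls l → ∀ᶠ y in 𝓕, p s y) :
    ∀ᶠ y in 𝓕, ∀ s, s.length = d → ls s ⊆ ls l → p s y := by
  have := (eventually_all_finite (l := 𝓕) (List.finite_toSet (tuples d l)) (p := fun s y => p s y)).2
    (fun s hs => h s (mem_tuples.1 hs).1 (mem_tuples.1 hs).2)
  exact this.mono fun y hy s h1 h2 => hy s (mem_tuples.2 ⟨h1, h2⟩)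

theorem EXT {𝓕 : Filter ℕ} (h𝓕 : ∀ N, ∀ᶠ y in 𝓕, N < y) {M : List ℕ → List ℕ → Prop} (hM : IsMat M)
    {d : ℕ} {l : List ℕ} (hl : Rb (d+1) M (ls l))
    (hd : ∀ s t, s.length = d → t.length = d → ls s ⊆ ls l → ls t ⊆ ls l → s ≠ t →
      ∀ᶠ y in 𝓕, ¬ M (y :: s) (y :: t)) :
    ∀ᶠ y in 𝓕, Rb (d+1) M (ls (y :: l)) := by
  have e1 : ∀ᶠ y in 𝓕, ∀ x ∈ l, x < y := by
    filter_upwards [h𝓕 l.sum] with y hy x hx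
    exact lt_of_le_of_lt (List.le_sum_of_mem hx) hy
  have e2 : ∀ᶠ y in 𝓕, ∀ s, s.length = d + 1 → ls s ⊆ ls l → ∀ t, M s (y :: t) → s = y :: t := by
    apply ev_tuples
    intro s hs hsl
    by_cases hu : ∃ u, s ≠ u ∧ M s u
    · obtain ⟨u, hu, hMu⟩ := hu
      filter_upwards [h𝓕 (u.headD 0)] with y hy t ht
      by_contra hne
      have := hM.mat _ _ _ hMu ht hu hne
      rw [this] at hy
      simp at hy
    · push Not at hu
      exact Eventually.of_forall fun y t ht => by_contra fun hne => hu _ hne ht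
  have e3 : ∀ᶠ y in 𝓕, ∀ s, s.length = d → ls s ⊆ ls l → ∀ t, t.length = d → ls t ⊆ ls l →
      M (y :: s) (y :: t) → s = t := by
    apply ev_tuples
    intro s hs hsl
    apply ev_tuples
    intro t ht htl
    by_cases hst : s = t
    · exact Eventually.of_forall fun _ _ => hst
    · filter_upwards [hd s t hs ht hsl htl hst] with y hy h
      exact absurd h hy
  filter_upwards [e1, e2, e3] with y h1 h2 h3 s t hs ht hsl htl hMst
  have key : ∀ s : List ℕ, s.length = d + 1 → ls s ⊆ ls (y :: l) → Desc s →
      ls s ⊆ ls l ∨ ∃ s', s = y :: s' ∧ s'.length = d ∧ ls s' ⊆ ls l := by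
    intro s hs hsl hD
    obtain _ | ⟨a, s⟩ := s
    · simp at hs
    have hD' := List.pairwise_cons.1 hD
    have ha : a ≤ y := by
      rcases List.mem_cons.1 (hsl (List.mem_cons_self : a ∈ a :: s)) with h | h
      · exact h.le
      · exact (h1 a h).le
    have hs' : ls s ⊆ ls l := by
      intro x hx
      rcases List.mem_cons.1 (hsl (List.mem_cons_of_mem a hx)) with h | h
      · have := hD'.1 x hx
        omega
      · exact h
    rcases List.mem_cons.1 (hsl (List.mem_cons_self : a ∈ a :: s)) with h | h
    · right; exact ⟨s, by rw [h], by simpa using hs, hs'⟩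
    · left
      intro x hx
      rcases List.mem_cons.1 hx with rfl | hx
      · exact h
      · exact hs' hx
  rcases key s hs hsl (hM.supp _ _ hMst).1 with hs1 | ⟨s', rfl, hs1, hs2⟩ <;>
  rcases key t ht htl (hM.supp _ _ hMst).2 with ht1 | ⟨t', rfl, ht1, ht2⟩
  · exact hl s t hs ht hs1 ht1 hMst
  · exact h2 s hs hs1 t' hMst
  · exact (h2 t ht ht1 s' (hM.symm _ _ hMst)).symm
  · rw [h3 s' hs1 hs2 t' ht1 ht2 hMst]

theorem fl_gt (X : Set ℕ) (N : ℕ) : ∀ᶠ y in fl X, N < y :=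
  ev_iff.2 ⟨N + 1, fun _ _ h => h⟩

theorem rb1_iff {M : List ℕ → List ℕ → Prop} {X : Set ℕ} :
    Rb 1 M X ↔ ∀ x ∈ X, ∀ y ∈ X, M [x] [y] → x = y := by
  constructor
  · intro h x hx y hy hm
    have := h [x] [y] rfl rfl (fun z hz => by simp at hz; rwa [hz]) (fun z hz => by simp at hz; rwa [hz]) hm
    simpa using this
  · intro h s t hs ht hsX htX hm
    obtain ⟨x, rfl⟩ := List.length_eq_one_iff.1 hs
    obtain ⟨y, rfl⟩ := List.length_eq_one_iff.1 ht
    rw [h x (hsX (by simp)) y (htX (by simp)) hm]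

theorem strong1F {w Z : ℕ → ℕ} {m : List ℕ → List ℕ → Prop} (hm : IsMat m) {F : List ℕ}
    (hF : Rb 1 m (ls F)) {X : Set ℕ} (hX : X.Infinite) (hA : AvX w Z X) :
    ∃ Y ⊆ X, Y.Infinite ∧ AvX w Z Y ∧ Rb 1 m (ls F ∪ Y) := by
  have := EXT (𝓕 := fl X) (fl_gt X) hm (d := 0) hF (by
    intro s t hs ht _ _ hne
    rw [List.length_eq_zero_iff] at hs ht
    exact absurd (hs.trans ht.symm) hne)
  obtain ⟨k, hk⟩ := ev_iff.1 this
  obtain ⟨Y, hYX, hY, hAY, h⟩ := RT1 (inf_tail hX k) (hA.tail k) {x | ∃ y < x, m [x] [y]}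
  refine ⟨Y, fun x hx => (hYX hx).1, hY, hAY, rb1_iff.2 ?_⟩
  have hFY : ∀ x ∈ F, ∀ y ∈ Y, m [x] [y] → x = y := by
    intro x hx y hy hxy
    exact rb1_iff.1 (hk y (hYX hy).1 (hYX hy).2) x (by simp [hx]) y (by simp) hxy
  have hlt : ∀ x ∈ Y, ∀ y ∈ Y, m [x] [y] → y < x → False := by
    intro x hx y hy hxy hlt
    rcases h with h | h
    · obtain ⟨z, hz, hyz⟩ := h hy
      have := hm.mat _ _ _ hyz (hm.symm _ _ hxy) (by simp; omega) (by simp; omega)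
      simp at this
      omega
    · exact h hx ⟨y, hlt, hxy⟩
  rintro x (hx | hx) y (hy | hy) hxy
  · exact rb1_iff.1 hF x hx y hy hxy
  · exact hFY x hx y hy hxy
  · exact (hFY y hy x hx (hm.symm _ _ hxy)).symm
  · rcases lt_trichotomy x y with h | h | h
    · exact (hlt y hy x hx (hm.symm _ _ hxy) h).elim
    · exact h
    · exact (hlt x hx y hy hxy h).elim

/-- limit relation along a filter -/
def lim (𝓕 : Filter ℕ) (M : List ℕ → List ℕ → Prop) (s t : List ℕ) : Prop :=
  ∀ᶠ y in 𝓕, M (y :: s) (y :: t)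

theorem isMat_lim {𝓕 : Filter ℕ} [𝓕.NeBot] {M : List ℕ → List ℕ → Prop} (hM : IsMat M) :
    IsMat (lim 𝓕 M) where
  supp s t h := by
    obtain ⟨y, hy⟩ := h.exists
    have := hM.supp _ _ hy
    exact ⟨(List.pairwise_cons.1 this.1).2, (List.pairwise_cons.1 this.2).2⟩
  symm s t h := h.mono fun y hy => hM.symm _ _ hy
  mat s t u h h' hne hne' := by
    obtain ⟨y, hy, hy'⟩ := (h.and h').exists
    have := hM.mat _ _ _ hy hy' (by simpa using hne) (by simpa using hne')
    simpa using this

/-- `M` is decidable relative to `Z` -/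
def DecIn (M : List ℕ → List ℕ → Prop) (Z : ℕ → ℕ) : Prop :=
  Sg Z (fun p : List ℕ × List ℕ => M p.1 p.2) ∧ Sg Z (fun p : List ℕ × List ℕ => ¬ M p.1 p.2)

/-- `C` is cohesive for the sections of `M` -/
def Coh (M : List ℕ → List ℕ → Prop) (C : Set ℕ) : Prop :=
  ∀ s t, (∀ᶠ y in fl C, M (y :: s) (y :: t)) ∨ (∀ᶠ y in fl C, ¬ M (y :: s) (y :: t))

theorem prim_true {α : Type} [Primcodable α] : PrimrecPred (fun _ : α => True) :=
  PrimrecPred.of_eq (p := fun _ : α => 0 = 0) (Primrec.eq.comp (Primrec.const 0) (Primrec.const 0))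
    (by simp)

theorem COH {w Z : ℕ → ℕ} {M : List ℕ → List ℕ → Prop} (hM : DecIn M Z) {X : Set ℕ}
    (hX : X.Infinite) (hA : AvX w Z X) : ∃ C ⊆ X, C.Infinite ∧ AvX w Z C ∧ Coh M C := by
  obtain ⟨C, h1, h2, h3, _, h4⟩ := MATHIAS hX hA (K := fun _ => True) (Sig.prim prim_true)
    (fun _ _ _ h => h) trivial (fun _ _ _ => Eventually.of_forall fun _ => trivial)
    (J := List ℕ × List ℕ) (fun st => {y | M (y :: st.1) (y :: st.2)}) (by
      rintro ⟨s, t⟩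
      have e : Primrec (fun y : ℕ => (y :: s, y :: t)) :=
        (Primrec.list_cons.comp Primrec.id (Primrec.const s)).pair
          (Primrec.list_cons.comp Primrec.id (Primrec.const t))
      exact LeF.chiOf (Y := fun _ : Unit => {y | M (y :: s) (y :: t)}) (hM.1.comp e) (hM.2.comp e))
  exact ⟨C, h1, h2, h3, fun s t => h4 (s, t)⟩

theorem THIN {w Z : ℕ → ℕ} {M : List ℕ → List ℕ → Prop} (hM : IsMat M) (hD : DecIn M Z)
    {C Y : Set ℕ} (hC : Coh M C) (hYC : Y ⊆ C) (hY : Y.Infinite) (hA : AvX w Z Y) {d : ℕ}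
    {F : List ℕ} (h1 : Rb d (lim (fl C) M) (ls F ∪ Y)) (h2 : Rb (d+1) M (ls F)) :
    ∃ Y' ⊆ Y, Y'.Infinite ∧ AvX w Z Y' ∧ Rb (d+1) M (ls F ∪ Y') := by
  classical
  obtain ⟨G, a, b, c, e, _⟩ := MATHIAS hY hA (K := fun l => Rb (d+1) M (ls (l ++ F)))
    (Sig.rb (M := fun _ => M) hD.2 (Primrec.list_append.comp Primrec.id (Primrec.const F)))
    (by
      intro l l' h hl
      apply hl.mono
      rw [ls_append, ls_append]
      exact Set.union_subset_union_left _ (fun x hx => h hx))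
    (by simpa using h2)
    (by
      intro l hl hK
      refine EXT (fl_gt Y) hM hK ?_
      intro s t hs ht hsl htl hne
      have hsub : ls (l ++ F) ⊆ ls F ∪ Y := by
        rw [ls_append, Set.union_comm]
        exact Set.union_subset_union_right _ hl
      rcases hC s t with h | h
      · exact absurd (h1 s t hs ht (hsl.trans hsub) (htl.trans hsub) h) hne
      · exact fl_mono hYC h)
    (J := Empty) (fun _ => ∅) (fun j => j.elim)
  refine ⟨G, a, b, c, ?_⟩
  intro s t hs ht hsG htG hm
  refine e ((s ++ t).filter (fun x => x ∈ G)) ?_ s t hs ht ?_ ?_ hm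
  · intro x hx
    simp only [mem_ls, List.mem_filter, decide_eq_true_eq] at hx
    exact hx.2
  · intro x hx
    rcases hsG hx with h | h
    · simp [show x ∈ F from h]
    · simp [show x ∈ s from hx, h]
  · intro x hx
    rcases htG hx with h | h
    · simp [show x ∈ F from h]
    · simp [show x ∈ t from hx, h]

theorem weak2F {w Z : ℕ → ℕ} {M : List ℕ → List ℕ → Prop} (hM : IsMat M) (hD : DecIn M Z)
    {X : Set ℕ} (hX : X.Infinite) (hA : AvX w Z X) {F : List ℕ}
    (hF : ∀ y ∈ X, Rb 2 M (ls (y :: F))) :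
    ∃ Y ⊆ X, Y.Infinite ∧ AvX w Z Y ∧ Rb 2 M (ls F ∪ Y) := by
  obtain ⟨C, hCX, hCi, hCA, hC⟩ := COH hD hX hA
  have := fl_neBot hCi
  have h1 : Rb 1 (lim (fl C) M) (ls F) := by
    intro s t hs ht hsF htF hm
    obtain ⟨k, hk⟩ := ev_iff.1 hm
    obtain ⟨y, hy, hky⟩ := hCi.exists_gt k
    have := hF y (hCX hy) (y :: s) (y :: t) (by simp [hs]) (by simp [ht]) ?_ ?_ (hk y hy hky.le)
    · simpa using this
    · intro x hx
      rcases List.mem_cons.1 hx with rfl | hx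
      · simp
      · exact List.mem_cons_of_mem _ (hsF hx)
    · intro x hx
      rcases List.mem_cons.1 hx with rfl | hx
      · simp
      · exact List.mem_cons_of_mem _ (htF hx)
  obtain ⟨Y, hYC, hYi, hYA, hY⟩ := strong1F (isMat_lim hM) h1 hCi hCA
  obtain ⟨y, hy⟩ := hX.nonempty
  obtain ⟨Y', a, b, c, e⟩ := THIN hM hD hC hYC hYi hYA hY
    ((hF y hy).mono fun x hx => List.mem_cons_of_mem _ hx)
  exact ⟨Y', (a.trans hYC).trans hCX, b, c, e⟩

end RRT

namespace RRT
open Encodable Filter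

theorem Sig.ndesc {ι α : Type} [Primcodable α] {O : ι → ℕ → ℕ} {f : α → List ℕ} (hf : Primrec f) :
    Sig O (fun _ a => ¬ Desc (f a)) := by
  have : Sig O (fun (_ : ι) (a : α) => ∃ q : (ℕ × ℕ) × (ℕ × ℕ), (q.1.1 < q.1.2 ∧ q.2.1 ≤ q.2.2) ∧
      ((f a)[q.1.1]? = some q.2.1 ∧ (f a)[q.1.2]? = some q.2.2)) := by
    apply Sig.ex (S := fun (_ : ι) (a : α) (q : (ℕ × ℕ) × (ℕ × ℕ)) => (q.1.1 < q.1.2 ∧ q.2.1 ≤ q.2.2) ∧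
      ((f a)[q.1.1]? = some q.2.1 ∧ (f a)[q.1.2]? = some q.2.2))
    have h11 : Primrec (fun r : α × (ℕ × ℕ) × (ℕ × ℕ) => r.2.1.1) :=
      Primrec.fst.comp (Primrec.fst.comp Primrec.snd)
    have h12 : Primrec (fun r : α × (ℕ × ℕ) × (ℕ × ℕ) => r.2.1.2) :=
      Primrec.snd.comp (Primrec.fst.comp Primrec.snd)
    have h21 : Primrec (fun r : α × (ℕ × ℕ) × (ℕ × ℕ) => r.2.2.1) :=
      Primrec.fst.comp (Primrec.snd.comp Primrec.snd)
    have h22 : Primrec (fun r : α × (ℕ × ℕ) × (ℕ × ℕ) => r.2.2.2) :=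
      Primrec.snd.comp (Primrec.snd.comp Primrec.snd)
    have hfa : Primrec (fun r : α × (ℕ × ℕ) × (ℕ × ℕ) => f r.1) := hf.comp Primrec.fst
    exact Sig.prim (((Primrec.nat_lt.comp h11 h12).and (Primrec.nat_le.comp h21 h22)).and
      ((Primrec.eq.comp (Primrec.list_getElem?.comp hfa h11) (Primrec.option_some.comp h21)).and
        (Primrec.eq.comp (Primrec.list_getElem?.comp hfa h12) (Primrec.option_some.comp h22))))
  refine this.of_eq fun i a => ?_
  rw [Desc, List.pairwise_iff_getElem]
  push Not
  constructor
  · rintro ⟨⟨⟨i, j⟩, ⟨x, y⟩⟩, ⟨h1, h2⟩, h3, h4⟩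
    obtain ⟨hi, h3⟩ := List.getElem?_eq_some_iff.1 h3
    obtain ⟨hj, h4⟩ := List.getElem?_eq_some_iff.1 h4
    exact ⟨i, j, hi, hj, h1, by rw [h3, h4]; exact h2⟩
  · rintro ⟨i, j, hi, hj, h1, h2⟩
    exact ⟨⟨⟨i, j⟩, ⟨_, _⟩⟩, ⟨h1, h2⟩, List.getElem?_eq_getElem hi, List.getElem?_eq_getElem hj⟩

/-- relation coded by an element of Cantor space -/
def Mh (h : ℕ → Bool) (s t : List ℕ) : Prop := h (encode (s, t)) = true

theorem Sig.mh {ι : Type} {O : ι → ℕ → ℕ} {h : ι → ℕ → Bool} (hh : LeF (fun i => bn (h i)) O) :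
    Sig O (fun i (p : List ℕ × List ℕ) => Mh (h i) p.1 p.2) :=
  (Sig.memX (LeF.hX hh) (Primrec.encode (α := List ℕ × List ℕ))).of_eq fun _ _ => Iff.rfl

theorem Sig.nmh {ι : Type} {O : ι → ℕ → ℕ} {h : ι → ℕ → Bool} (hh : LeF (fun i => bn (h i)) O) :
    Sig O (fun i (p : List ℕ × List ℕ) => ¬ Mh (h i) p.1 p.2) :=
  (Sig.notMemX (LeF.hX hh) (Primrec.encode (α := List ℕ × List ℕ))).of_eq fun _ _ => Iff.rfl

theorem Sig.nmat {ι α : Type} [Primcodable α] {O : ι → ℕ → ℕ} {h : ι → ℕ → Bool}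
    (hh : LeF (fun i => bn (h i)) O) : Sig O (fun i (_ : α) => ¬ IsMat (Mh (h i))) := by
  have a1 := Sig.mh hh
  have a2 := Sig.nmh hh
  have b1 : Sig O (fun i (_ : α) => ∃ p : List ℕ × List ℕ, Mh (h i) p.1 p.2 ∧ (¬ Desc p.1 ∨ ¬ Desc p.2)) := by
    apply Sig.ex (S := fun i (_ : α) (p : List ℕ × List ℕ) => Mh (h i) p.1 p.2 ∧ (¬ Desc p.1 ∨ ¬ Desc p.2))
    exact (a1.comp (f := fun q : α × List ℕ × List ℕ => q.2) Primrec.snd).and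
      ((Sig.ndesc (Primrec.fst.comp Primrec.snd)).or (Sig.ndesc (Primrec.snd.comp Primrec.snd)))
  have b2 : Sig O (fun i (_ : α) => ∃ p : List ℕ × List ℕ, Mh (h i) p.1 p.2 ∧ ¬ Mh (h i) p.2 p.1) := by
    apply Sig.ex (S := fun i (_ : α) (p : List ℕ × List ℕ) => Mh (h i) p.1 p.2 ∧ ¬ Mh (h i) p.2 p.1)
    exact (a1.comp (f := fun q : α × List ℕ × List ℕ => q.2) Primrec.snd).and
      (a2.comp (f := fun q : α × List ℕ × List ℕ => (q.2.2, q.2.1))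
        ((Primrec.snd.comp Primrec.snd).pair (Primrec.fst.comp Primrec.snd)))
  have b3 : Sig O (fun i (_ : α) => ∃ p : List ℕ × List ℕ × List ℕ, (Mh (h i) p.1 p.2.1 ∧
      Mh (h i) p.1 p.2.2) ∧ (p.1 ≠ p.2.1 ∧ p.1 ≠ p.2.2) ∧ p.2.1 ≠ p.2.2) := by
    apply Sig.ex (S := fun i (_ : α) (p : List ℕ × List ℕ × List ℕ) => (Mh (h i) p.1 p.2.1 ∧
      Mh (h i) p.1 p.2.2) ∧ (p.1 ≠ p.2.1 ∧ p.1 ≠ p.2.2) ∧ p.2.1 ≠ p.2.2)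
    have e1 : Primrec (fun q : α × List ℕ × List ℕ × List ℕ => q.2.1) := Primrec.fst.comp Primrec.snd
    have e2 : Primrec (fun q : α × List ℕ × List ℕ × List ℕ => q.2.2.1) :=
      Primrec.fst.comp (Primrec.snd.comp Primrec.snd)
    have e3 : Primrec (fun q : α × List ℕ × List ℕ × List ℕ => q.2.2.2) :=
      Primrec.snd.comp (Primrec.snd.comp Primrec.snd)
    exact ((a1.comp (e1.pair e2)).and (a1.comp (e1.pair e3))).and (Sig.prim
      (((Primrec.eq.comp e1 e2).not.and (Primrec.eq.comp e1 e3).not).and (Primrec.eq.comp e2 e3).not))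
  refine (b1.or (b2.or b3)).of_eq fun i _ => ?_
  constructor
  · rintro (⟨p, h1, h2⟩ | ⟨p, h1, h2⟩ | ⟨p, ⟨h1, h2⟩, ⟨h3, h4⟩, h5⟩) hm
    · have := hm.supp _ _ h1; tauto
    · exact h2 (hm.symm _ _ h1)
    · exact h5 (hm.mat _ _ _ h1 h2 h3 h4)
  · intro hm
    by_contra hc
    push Not at hc
    obtain ⟨c1, c2, c3⟩ := hc
    refine hm ⟨fun s t => c1 (s, t), fun s t => c2 (s, t), fun s t u h1 h2 h3 h4 => ?_⟩
    exact c3 (s, t, u) ⟨h1, h2⟩ ⟨h3, h4⟩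

theorem ultra {w Z : ℕ → ℕ} {X : Set ℕ} (hX : X.Infinite) (hA : AvX w Z X) :
    ∃ 𝒰 : Ultrafilter ℕ, X ∈ 𝒰 ∧ (∀ N, ∀ᶠ y in (𝒰 : Filter ℕ), N < y) ∧
      ∀ B ∈ 𝒰, ∃ Y ⊆ B, Y ⊆ X ∧ Y.Infinite ∧ AvX w Z Y := by
  let 𝓕 : Filter ℕ :=
    { sets := {A | ∀ Y ⊆ X, Y.Infinite → AvX w Z Y → ¬ Y ⊆ Aᶜ}
      univ_sets := by
        intro Y _ hY _ h
        apply hY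
        rw [Set.compl_univ, Set.subset_empty_iff] at h
        rw [h]; exact Set.finite_empty
      sets_of_superset := by
        intro A B hAs hAB Y h1 h2 h3 h4
        exact hAs Y h1 h2 h3 (h4.trans (Set.compl_subset_compl.2 hAB))
      inter_sets := by
        intro A B hAs hBs Y h1 h2 h3 h4
        obtain ⟨Y', g1, g2, g3, g4 | g4⟩ := RT1 h2 h3 A
        · refine hBs Y' (g1.trans h1) g2 g3 fun x hx hxB => h4 (g1 hx) ⟨g4 hx, hxB⟩
        · exact hAs Y' (g1.trans h1) g2 g3 g4 }
  have hmem : ∀ A, A ∈ 𝓕 ↔ ∀ Y ⊆ X, Y.Infinite → AvX w Z Y → ¬ Y ⊆ Aᶜ := fun A => Iff.rfl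
  have hne : 𝓕.NeBot := by
    rw [neBot_iff]
    intro h
    have : (∅ : Set ℕ) ∈ 𝓕 := by rw [h]; exact mem_bot
    exact this X (fun _ h => h) hX hA (by simp)
  refine ⟨Ultrafilter.of 𝓕, ?_, ?_, ?_⟩
  · apply Ultrafilter.of_le 𝓕
    rw [hmem]
    intro Y h1 h2 _ h4
    obtain ⟨y, hy⟩ := h2.nonempty
    exact h4 hy (h1 hy)
  · intro N
    apply Ultrafilter.of_le 𝓕
    rw [hmem]
    intro Y h1 h2 _ h4
    obtain ⟨y, hy, hN⟩ := h2.exists_gt N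
    exact h4 hy hN
  · intro B hB
    by_contra hc
    have : Bᶜ ∈ 𝓕 := by
      rw [hmem]
      intro Y h1 h2 h3 h4
      exact hc ⟨Y, by simpa using h4, h1, h2, h3⟩
    exact Ultrafilter.compl_notMem_iff.2 hB (Ultrafilter.of_le 𝓕 this)

theorem ext2 {w Z : ℕ → ℕ} {X : Set ℕ} {M : List ℕ → List ℕ → Prop} (hM : IsMat M)
    {𝒰 : Ultrafilter ℕ} (h2 : ∀ N, ∀ᶠ y in (𝒰 : Filter ℕ), N < y)
    (h3 : ∀ B ∈ 𝒰, ∃ Y ⊆ B, Y ⊆ X ∧ Y.Infinite ∧ AvX w Z Y) {l : List ℕ} (hl : Rb 2 M (ls l))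
    (hl1 : Rb 1 (lim 𝒰 M) (ls l)) (k : ℕ) :
    ∃ Y ⊆ X, Y.Infinite ∧ AvX w Z Y ∧ (∀ y ∈ Y, k ≤ y) ∧ ∀ y ∈ Y, Rb 2 M (ls (y :: l)) := by
  have h4 : ∀ᶠ y in (𝒰 : Filter ℕ), Rb 2 M (ls (y :: l)) := by
    refine EXT h2 hM hl ?_
    intro s t hs ht hsl htl hne
    rw [Ultrafilter.eventually_not]
    exact fun h => hne (hl1 s t hs ht hsl htl h)
  obtain ⟨Y, a, b, c, d⟩ := h3 _ ((h2 k).and h4)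
  exact ⟨Y, b, c, d, fun y hy => (a hy).1.le, fun y hy => (a hy).2⟩

theorem rb_cons_sub {s F : List ℕ} {y : ℕ} (h : ls s ⊆ ls F) : ls (y :: s) ⊆ ls (y :: F) := by
  intro x hx
  rcases List.mem_cons.1 hx with rfl | hx
  · simp
  · exact List.mem_cons_of_mem _ (h hx)

theorem lim_free {X : Set ℕ} {M : List ℕ → List ℕ → Prop} {𝒰 : Ultrafilter ℕ} (h1 : X ∈ 𝒰)
    {F : List ℕ} (hF : ∀ y ∈ X, Rb 2 M (ls (y :: F))) : Rb 1 (lim 𝒰 M) (ls F) := by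
  intro s t hs ht hsF htF hm
  have h1 : ∀ᶠ y in (𝒰 : Filter ℕ), y ∈ X := h1
  obtain ⟨y, hy, hyX⟩ := (Eventually.and hm h1).exists
  have := hF y hyX (y :: s) (y :: t) (by simp [hs]) (by simp [ht]) (rb_cons_sub hsF)
    (rb_cons_sub htF) hy
  simpa using this

theorem strong2_step {w Z : ℕ → ℕ} {M : List ℕ → List ℕ → Prop} (hM : IsMat M) (D : PD)
    {F : List ℕ} {X : Set ℕ} (hX : X.Infinite) (hA : AvX w Z X)
    (hF : ∀ y ∈ X, Rb 2 M (ls (y :: F))) :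
    ∃ (F' : List ℕ) (X' : Set ℕ), X'.Infinite ∧ AvX w Z X' ∧ (∀ y ∈ X', Rb 2 M (ls (y :: F'))) ∧
      (∀ G, ls F' ⊆ G → G ⊆ ls F' ∪ X' → Req w D (opair Z (chi G))) ∧
      F ⊆ F' ∧ ls F' ⊆ ls F ∪ X ∧ X' ⊆ X := by
  classical
  let U : (ℕ → Bool) → ℕ × ℕ → Prop := fun h p =>
    (¬ IsMat (Mh h) ∨ (∃ y, y ∈ X ∧ ¬ Rb 2 (Mh h) (ls (y :: F))) ∨ ¬ Rb 1 (Mh h) (ls F)) ∨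
    ∃ E : List ℕ, (∀ x ∈ E, x ∈ X) ∧ (Rb 2 (Mh h) (ls (E ++ F)) ∧ Rb 1 (Mh h) (ls (E ++ F))) ∧
      op D.1 (opair Z (chi (ls (E ++ F)))) p
  have hU : Sig (fun h : ℕ → Bool => opair (opair Z (chi X)) (bn h)) U := by
    have a1 : LeF (fun _ : ℕ → Bool => Z) (fun h : ℕ → Bool => opair (opair Z (chi X)) (bn h)) :=
      (LeF.cst Le.left').trans LeF.left
    have a2 : LeF (fun _ : ℕ → Bool => chi X) (fun h : ℕ → Bool => opair (opair Z (chi X)) (bn h)) :=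
      (LeF.cst Le.right').trans LeF.left
    have a3 : LeF (fun h => bn h) (fun h : ℕ → Bool => opair (opair Z (chi X)) (bn h)) := LeF.right
    have b1 := Sig.mh (h := fun h => h) a3
    have b2 := Sig.nmh (h := fun h => h) a3
    apply Sig.or
    · refine (Sig.nmat (h := fun h => h) a3).or (Sig.or ?_ ?_)
      · apply Sig.ex (S := fun h (_ : ℕ × ℕ) (y : ℕ) => y ∈ X ∧ ¬ Rb 2 (Mh h) (ls (y :: F)))
        exact (Sig.memX a2 Primrec.snd).and (Sig.nrb (M := fun h => Mh h) b1
          (Primrec.list_cons.comp Primrec.snd (Primrec.const F)))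
      · exact Sig.nrb (M := fun h => Mh h) b1 (Primrec.const F)
    · apply Sig.ex (S := fun h (p : ℕ × ℕ) (E : List ℕ) => (∀ x ∈ E, x ∈ X) ∧
        (Rb 2 (Mh h) (ls (E ++ F)) ∧ Rb 1 (Mh h) (ls (E ++ F))) ∧
        op D.1 (opair Z (chi (ls (E ++ F)))) p)
      have e : Primrec (fun q : (ℕ × ℕ) × List ℕ => q.2 ++ F) :=
        Primrec.list_append.comp Primrec.snd (Primrec.const F)
      exact (Sig.memall a2 Primrec.snd).and (((Sig.rb (M := fun h => Mh h) b2 e).and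
        (Sig.rb (M := fun h => Mh h) b2 e)).and (Sig.opE a1 e Primrec.fst))
  have hS : Sg (opair Z (chi X)) (fun p : ℕ × ℕ => ∀ h, U h p) := by
    apply Sig.allh (S := fun (_ : Unit) h p => U h p)
    exact hU.reindex (fun ih : Unit × (ℕ → Bool) => ih.2)
  obtain ⟨n, ⟨i, hi, h⟩ | h⟩ := hA.dich hS
  · obtain ⟨𝒰, u1, u2, u3⟩ := ultra hX hA
    let m := lim 𝒰 M
    have hm : IsMat m := isMat_lim hM
    let N : List ℕ → List ℕ → Prop := fun s t =>
      ((s.length = 2 ∧ t.length = 2) ∧ M s t) ∨ ((s.length = 1 ∧ t.length = 1) ∧ m s t)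
    have hN : IsMat N := by
      refine ⟨?_, ?_, ?_⟩
      · rintro s t (h | h)
        · exact hM.supp _ _ h.2
        · exact hm.supp _ _ h.2
      · rintro s t (h | h)
        · exact Or.inl ⟨h.1.symm, hM.symm _ _ h.2⟩
        · exact Or.inr ⟨h.1.symm, hm.symm _ _ h.2⟩
      · rintro s t u (h | h) (h' | h') h1 h2
        · exact hM.mat _ _ _ h.2 h'.2 h1 h2
        · have := h.1.1; have := h'.1.1; omega
        · have := h.1.1; have := h'.1.1; omega
        · exact hm.mat _ _ _ h.2 h'.2 h1 h2
    let g : ℕ → Bool := fun x => decide (∃ s t, x = encode (s, t) ∧ N s t)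
    have hg : Mh g = N := by
      funext s t
      apply propext
      simp only [Mh, g, decide_eq_true_eq]
      constructor
      · rintro ⟨s', t', h1, h2⟩
        have := encode_injective h1
        simp only [Prod.mk.injEq] at this
        rw [this.1, this.2]; exact h2
      · exact fun h => ⟨s, t, rfl, h⟩
    have n2 : ∀ Y, Rb 2 N Y ↔ Rb 2 M Y := by
      intro Y
      refine forall_congr' fun s => forall_congr' fun t => forall_congr' fun hs =>
        forall_congr' fun ht => forall_congr' fun _ => forall_congr' fun _ => ?_
      simp [N, hs, ht]
    have n1 : ∀ Y, Rb 1 N Y ↔ Rb 1 m Y := by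
      intro Y
      refine forall_congr' fun s => forall_congr' fun t => forall_congr' fun hs =>
        forall_congr' fun ht => forall_congr' fun _ => forall_congr' fun _ => ?_
      simp [N, hs, ht]
    have hUg := h g
    simp only [U, hg] at hUg
    rcases hUg with (h | ⟨y, hy, h⟩ | h) | ⟨E, hE, ⟨hE2, hE1⟩, hop⟩
    · exact absurd hN h
    · exact absurd ((n2 _).2 (hF y hy)) h
    · exact absurd ((n1 _).2 (lim_free u1 hF)) h
    · obtain ⟨k, hk⟩ := force_pos hop
      obtain ⟨Y, hYX, hY, hAY, hYk, hYM⟩ := ext2 hM u2 u3 ((n2 _).1 hE2) ((n1 _).1 hE1) k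
      refine ⟨E ++ F, Y, hY, hAY, hYM, ?_, by simp, ?_, hYX⟩
      · intro G hG1 hG2
        exact ⟨n, Or.inl ⟨i, hi, hk G hG1 fun x hx => (hG2 hx).imp id fun h => hYk x h⟩⟩
      · rw [ls_append, Set.union_comm]
        exact Set.union_subset_union_right _ (fun x hx => hE x hx)
  · push Not at h
    obtain ⟨g, hg, hAg⟩ := basis hA (T := fun g => U g (n, w n))
      (hU.comp (f := fun _ : Unit => (n, w n)) (Primrec.const _)) h
    simp only [U, not_or, not_not, not_exists, not_and] at hg
    obtain ⟨⟨g1, g2, g3⟩, g4⟩ := hg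
    have hA1 : AvX w (opair Z (bn g)) X := by
      refine AvX.of_Le hAg (LeF.pair ?_ ?_) (Le.right'.trans Le.left')
      · exact Le.left'.trans Le.left'
      · exact Le.right'
    have hgd : DecIn (Mh g) (opair Z (bn g)) :=
      ⟨Sig.mh (h := fun _ : Unit => g) Le.right', Sig.nmh (h := fun _ : Unit => g) Le.right'⟩
    obtain ⟨Y1, hY1, hY1i, hY1A, hY1r⟩ := strong1F g1 g3 hX hA1
    obtain ⟨Y, hY, hYi, hYA, hYr⟩ := weak2F g1 hgd hY1i hY1A (fun y hy => g2 y (hY1 hy))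
    refine ⟨F, Y, hYi, AvX.of_Le hYA (Le.left'.trans Le.left') Le.right',
      fun y hy => hF y (hY1 (hY hy)), ?_, fun _ h => h, Set.subset_union_left, hY.trans hY1⟩
    intro G hG1 hG2
    refine ⟨n, Or.inr fun hop => ?_⟩
    obtain ⟨E, hE, hop⟩ := force_neg hop hG1 hG2
    have hsub : ls (E ++ F) ⊆ ls F ∪ Y := by
      rw [ls_append, Set.union_comm]
      exact Set.union_subset_union_right _ (fun x hx => (hE x hx).1)
    exact g4 E (fun x hx => hY1 (hY (hE x hx).1)) ⟨hYr.mono hsub,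
      hY1r.mono (hsub.trans (Set.union_subset_union_right _ hY))⟩ hop

theorem STRONG2 {w Z : ℕ → ℕ} {M : List ℕ → List ℕ → Prop} (hM : IsMat M)
    {X : Set ℕ} (hX : X.Infinite) (hA : AvX w Z X) :
    ∃ Y ⊆ X, Y.Infinite ∧ AvX w Z Y ∧ Rb 2 M Y := by
  let C : List ℕ → Set ℕ → Prop := fun F Y => Y.Infinite ∧ AvX w Z Y ∧ ∀ y ∈ Y, Rb 2 M (ls (y :: F))
  let P : PD ⊕ ℕ → List ℕ → Set ℕ → Prop := fun j F Y => match j with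
    | .inl D => ∀ G, ls F ⊆ G → G ⊆ ls F ∪ Y → Req w D (opair Z (chi G))
    | .inr n => ∃ x ∈ F, n ≤ x
  have hC0 : C [] X := by
    refine ⟨hX, hA, fun y _ s t hs ht hs1 ht1 hm => ?_⟩
    have key : ∀ s : List ℕ, s.length = 2 → ls s ⊆ ls [y] → ¬ Desc s := by
      intro s hs hsl hd
      obtain ⟨a, b, rfl⟩ := List.length_eq_two.1 hs
      have h1 : a = y := by simpa using hsl (show a ∈ [a, b] by simp)
      have h2 : b = y := by simpa using hsl (show b ∈ [a, b] by simp)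
      simp [Desc, h1, h2] at hd
    exact absurd (hM.supp _ _ hm).1 (key s hs hs1)
  obtain ⟨G, h1, h2, h3, h4⟩ := GEN C P (by
    rintro (D | n) F Y ⟨hY, hAY, hYF⟩
    · obtain ⟨F', X', a, b, c, d, e, f, g⟩ := strong2_step hM D hY hAY hYF
      exact ⟨F', X', ⟨a, b, c⟩, d, e, f, g⟩
    · obtain ⟨𝒰, u1, u2, u3⟩ := ultra hY hAY
      have hm := EXT u2 (isMat_lim hM) (𝓕 := 𝒰) (M := lim 𝒰 M) (d := 0) (lim_free u1 hYF) (by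
        intro s t hs ht _ _ hne
        rw [List.length_eq_zero_iff] at hs ht
        exact absurd (hs.trans ht.symm) hne)
      have u1' : ∀ᶠ y in (𝒰 : Filter ℕ), y ∈ Y := u1
      obtain ⟨y, hy1, hy2, hy3⟩ := (hm.and (u1'.and (u2 n))).exists
      obtain ⟨Y', a, b, c, _, d⟩ := ext2 hM u2 u3 (hYF y hy2) hy1 0
      refine ⟨y :: F, Y', ⟨b, c, d⟩, ⟨y, by simp, hy3.le⟩, by simp, ?_, a⟩
      intro x hx
      rcases List.mem_cons.1 hx with rfl | hx
      · exact Or.inr hy2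
      · exact Or.inl hx)
    [] X hC0
  refine ⟨G, fun x hx => (h2 hx).resolve_left (by simp), ?_, ?_, ?_⟩
  · apply Set.infinite_of_forall_exists_gt
    intro n
    obtain ⟨F, Y, _, ⟨x, hx, hn⟩, hF, _⟩ := h4 (.inr (n+1))
    exact ⟨x, hF hx, hn⟩
  · apply Av.of_req
    intro D
    obtain ⟨F, Y, _, h, hF, hG⟩ := h4 (.inl D)
    exact h G hF hG
  · intro s t hs ht hsG htG hm
    obtain ⟨F, Y, hC, hlF, _⟩ := h3 (s ++ t) (by rw [ls_append]; exact Set.union_subset hsG htG)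
    obtain ⟨y, hy⟩ := hC.1.nonempty
    refine hC.2.2 y hy s t hs ht ?_ ?_ hm
    · exact fun x hx => List.mem_cons_of_mem _ (hlF (List.mem_append_left _ hx))
    · exact fun x hx => List.mem_cons_of_mem _ (hlF (List.mem_append_right _ hx))

end RRT

namespace RRT
open Encodable

/-! ### Colorings of triples and the final construction -/

theorem le_univ {O : ℕ → ℕ} : Le (chi Set.univ) O := by
  have := Le.Ici 0 (O := O)
  have e : (Set.Ici 0 : Set ℕ) = Set.univ := by ext; simp
  rwa [e] at this

/-- decreasing triples -/
def Tri (s : List ℕ) : Prop :=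
  s.length = 3 ∧ s.getD 2 0 < s.getD 1 0 ∧ s.getD 1 0 < s.getD 0 0

theorem tri_prim : PrimrecPred Tri := by
  have g : ∀ k : ℕ, Primrec (fun s : List ℕ => s.getD k 0) := fun k =>
    (Primrec.list_getD 0).comp Primrec.id (Primrec.const k)
  exact (Primrec.eq.comp Primrec.list_length (Primrec.const 3)).and
    ((Primrec.nat_lt.comp (g 2) (g 1)).and (Primrec.nat_lt.comp (g 1) (g 0)))

theorem tri_iff {s : List ℕ} : Tri s ↔ ∃ x y z, x < y ∧ y < z ∧ s = [z, y, x] := by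
  constructor
  · rintro ⟨h1, h2, h3⟩
    obtain ⟨a, b, c, rfl⟩ := List.length_eq_three.1 h1
    exact ⟨c, b, a, by simpa using h2, by simpa using h3, rfl⟩
  · rintro ⟨x, y, z, h1, h2, rfl⟩
    exact ⟨rfl, by simpa using h1, by simpa using h2⟩

/-- the code of a triple -/
def cd (s : List ℕ) : ℕ := Nat.pair (s.getD 2 0) (Nat.pair (s.getD 1 0) (s.getD 0 0))

theorem cd_prim : Primrec cd := by
  have g : ∀ k : ℕ, Primrec (fun s : List ℕ => s.getD k 0) := fun k =>
    (Primrec.list_getD 0).comp Primrec.id (Primrec.const k)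
  exact Primrec₂.natPair.comp (g 2) (Primrec₂.natPair.comp (g 1) (g 0))

def MF (F : ℕ → ℕ) (s t : List ℕ) : Prop := Tri s ∧ Tri t ∧ F (cd s) = F (cd t)

/-- the coloring coded by `F` -/
def colF (F : ℕ → ℕ) (x y z : ℕ) : ℕ := F (Nat.pair x (Nat.pair y z))

theorem isMat_MF {F : ℕ → ℕ} (hF : Bounded2Triples (colF F)) : IsMat (MF F) where
  supp s t h := by
    obtain ⟨h1, h2, -⟩ := h
    have key : ∀ s, Tri s → Desc s := by
      intro s hs
      obtain ⟨x, y, z, h1, h2, rfl⟩ := tri_iff.1 hs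
      simp [Desc]; omega
    exact ⟨key s h1, key t h2⟩
  symm s t h := ⟨h.2.1, h.1, h.2.2.symm⟩
  mat s t u h h' hst hsu := by
    by_contra htu
    obtain ⟨hs, ht, e⟩ := h
    obtain ⟨-, hu, e'⟩ := h'
    obtain ⟨x, y, z, a1, a2, rfl⟩ := tri_iff.1 hs
    obtain ⟨x', y', z', b1, b2, rfl⟩ := tri_iff.1 ht
    obtain ⟨x₂, y₂, z₂, c1, c2, rfl⟩ := tri_iff.1 hu
    simp only [cd, List.getD_cons_succ, List.getD_cons_zero] at e e'
    have hb := hF (colF F x y z)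
    have hsub : ({(x, y, z), (x', y', z'), (x₂, y₂, z₂)} : Set (ℕ × ℕ × ℕ)) ⊆
        {t : ℕ × ℕ × ℕ | t.1 < t.2.1 ∧ t.2.1 < t.2.2 ∧ colF F t.1 t.2.1 t.2.2 = colF F x y z} := by
      rintro p (rfl | rfl | rfl)
      · exact ⟨a1, a2, rfl⟩
      · exact ⟨b1, b2, e.symm⟩
      · exact ⟨c1, c2, e'.symm⟩
    have h3 : ({(x, y, z), (x', y', z'), (x₂, y₂, z₂)} : Set (ℕ × ℕ × ℕ)).encard = 3 := by
      apply Set.encard_eq_three.2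
      refine ⟨_, _, _, ?_, ?_, ?_, rfl⟩
      · rintro h; simp only [Prod.mk.injEq] at h; simp [h] at hst
      · rintro h; simp only [Prod.mk.injEq] at h; simp [h] at hsu
      · rintro h; simp only [Prod.mk.injEq] at h; simp [h] at htu
    have := (Set.encard_le_encard hsub).trans hb
    rw [h3] at this
    exact absurd this (by decide)

theorem decIn_MF {F O : ℕ → ℕ} (hF : Le F O) : DecIn (MF F) O := by
  have hf : ∀ c : ℕ → ℕ → Prop, PrimrecRel c → Sg O (fun p : List ℕ × List ℕ =>
      c (F (cd p.1)) (F (cd p.2))) := by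
    intro c hc
    have hS : Sg O (fun p : List ℕ × List ℕ => ∃ q : ℕ × ℕ,
        (F (cd p.1) = q.1 ∧ F (cd p.2) = q.2) ∧ c q.1 q.2) := by
      apply Sig.ex (S := fun _ (p : List ℕ × List ℕ) (q : ℕ × ℕ) =>
        (F (cd p.1) = q.1 ∧ F (cd p.2) = q.2) ∧ c q.1 q.2)
      refine Sig.and (Sig.and ?_ ?_) (Sig.prim ?_)
      · exact Sig.comp hF (f := fun r : (List ℕ × List ℕ) × ℕ × ℕ => (cd r.1.1, r.2.1))
          ((cd_prim.comp (Primrec.fst.comp Primrec.fst)).pair (Primrec.fst.comp Primrec.snd))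
      · exact Sig.comp hF (f := fun r : (List ℕ × List ℕ) × ℕ × ℕ => (cd r.1.2, r.2.2))
          ((cd_prim.comp (Primrec.snd.comp Primrec.fst)).pair (Primrec.snd.comp Primrec.snd))
      · exact hc.comp (Primrec.fst.comp Primrec.snd) (Primrec.snd.comp Primrec.snd)
    refine hS.of_eq fun _ p => ⟨?_, fun h => ⟨(_, _), ⟨rfl, rfl⟩, h⟩⟩
    rintro ⟨q, ⟨h1, h2⟩, h3⟩
    rwa [h1, h2]
  have t1 : PrimrecPred (fun p : List ℕ × List ℕ => Tri p.1) := tri_prim.comp Primrec.fst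
  have t2 : PrimrecPred (fun p : List ℕ × List ℕ => Tri p.2) := tri_prim.comp Primrec.snd
  have e1 : PrimrecRel (fun a b : ℕ => a = b) := Primrec.eq
  have e2 : PrimrecRel (fun a b : ℕ => ¬ a = b) := e1.not
  refine ⟨(Sig.prim t1).and ((Sig.prim t2).and (hf _ e1)), ?_⟩
  refine ((Sig.prim t1.not).or ((Sig.prim t2.not).or (hf _ e2))).of_eq fun _ p => ?_
  simp only [MF]; tauto

theorem weak3 {w O F : ℕ → ℕ} (hA : Av w O) (hF : Le F O) (hb : Bounded2Triples (colF F)) :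
    ∃ Y : Set ℕ, AvX w O Y ∧ Y.Infinite ∧ Rainbow3On (colF F) Y := by
  have hM := isMat_MF hb
  have hD := decIn_MF hF
  obtain ⟨C, -, hC, hCA, hCoh⟩ := COH hD Set.infinite_univ
    (AvX.of_Le hA (LeF.refl) le_univ : AvX w O Set.univ)
  have := fl_neBot hC
  obtain ⟨Y, hYC, hY, hYA, hR⟩ := STRONG2 (isMat_lim (𝓕 := fl C) hM) hC hCA
  have e0 : ls [] = ∅ := by ext; simp
  obtain ⟨Y', -, hY', hYA', hR'⟩ := THIN hM hD hCoh hYC hY hYA (d := 2) (F := [])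
    (by rw [e0, Set.empty_union]; exact hR) (by
      intro s t hs ht hs1
      obtain ⟨a, b, c, rfl⟩ := List.length_eq_three.1 hs
      have : a ∈ ls [] := hs1 (by simp)
      simp at this)
  rw [e0, Set.empty_union] at hR'
  refine ⟨Y', hYA', hY', ?_⟩
  intro x y z x' y' z' hx hy hz hx' hy' hz' a1 a2 b1 b2 e
  have := hR' [z, y, x] [z', y', x'] rfl rfl (by intro a; simp; rintro (rfl | rfl | rfl) <;> assumption)
    (by intro a; simp; rintro (rfl | rfl | rfl) <;> assumption)
    ⟨tri_iff.2 ⟨_, _, _, a1, a2, rfl⟩, tri_iff.2 ⟨_, _, _, b1, b2, rfl⟩, e⟩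
  simp at this
  tauto

theorem countable_le (O : ℕ → ℕ) : {F : ℕ → ℕ | Le F O}.Countable := by
  have := countable_prim (α := List ℕ × ℕ × ℕ)
  have : ∀ F : {F : ℕ → ℕ | Le F O}, ∃ D : {D : List ℕ × ℕ × ℕ → Prop // PrimrecPred D},
      ∀ p, F.1 p.1 = p.2 ↔ ∃ k, D.1 (pre O k, p) := by
    rintro ⟨F, D, hD, h⟩
    exact ⟨⟨D, hD⟩, fun p => h () p⟩
  choose g hg using this
  have hi : Function.Injective g := by
    intro F F' h
    apply Subtype.ext
    funext n
    have := (hg F' (n, F'.1 n)).1 rfl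
    rw [← h, ← hg F] at this
    exact this
  exact hi.countable

theorem exists_enum (O : ℕ → ℕ) : ∃ E : ℕ → ℕ → ℕ, ∀ F, Le F O → ∃ e, E e = F := by
  obtain ⟨E, hE⟩ := (countable_le O).exists_eq_range ⟨O, LeF.refl⟩
  exact ⟨E, fun F hF => by
    have : F ∈ Set.range E := hE ▸ hF
    exact this⟩

/-- left projection of a paired oracle -/
def lp (O : ℕ → ℕ) : ℕ → ℕ := fun n => (O n).unpair.1

theorem lp_opair (A B : ℕ → ℕ) : lp (opair A B) = A := by funext n; simp [lp, opair]

theorem Le.join {A B : Set ℕ} {O : ℕ → ℕ} (hA : Le (chi A) O) (hB : Le (chi B) O) :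
    Le (chi (join A B)) O := by
  have hd : Primrec (fun n : ℕ => n / 2) := Primrec.nat_div.comp Primrec.id (Primrec.const 2)
  have hm : PrimrecPred (fun n : ℕ => n % 2 = 0) :=
    Primrec.eq.comp (Primrec.nat_mod.comp Primrec.id (Primrec.const 2)) (Primrec.const 0)
  have key : ∀ n, n ∈ RRT.join A B ↔ (n % 2 = 0 ∧ n / 2 ∈ A) ∨ (¬ n % 2 = 0 ∧ n / 2 ∈ B) := by
    intro n
    constructor
    · rintro (⟨m, hm, rfl⟩ | ⟨m, hm, rfl⟩)
      · left; exact ⟨by omega, by rwa [show 2 * m / 2 = m by omega]⟩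
      · right; exact ⟨by omega, by rwa [show (2 * m + 1) / 2 = m by omega]⟩
    · rintro (⟨h, h'⟩ | ⟨h, h'⟩)
      · exact Or.inl ⟨_, h', by omega⟩
      · exact Or.inr ⟨_, h', by omega⟩
  apply LeF.chiOf (Y := fun _ : Unit => RRT.join A B)
  · exact (((Sig.prim hm).and (Sig.memX (X := fun _ => A) hA hd)).or
      ((Sig.prim hm.not).and (Sig.memX (X := fun _ => B) hB hd))).of_eq fun _ n => (key n).symm
  · refine (((Sig.prim hm).and (Sig.notMemX (X := fun _ => A) hA hd)).or
      ((Sig.prim hm.not).and (Sig.notMemX (X := fun _ => B) hB hd))).of_eq fun _ n => ?_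
    rw [key n]; tauto

theorem final (W : Set ℕ) (hW : ¬ TuringLE W ∅) :
    ∃ S : Set (Set ℕ), S.Countable ∧
      (∀ A : Set ℕ, TuringLE A ∅ → A ∈ S) ∧
      (∀ A ∈ S, ∀ B : Set ℕ, TuringLE B A → B ∈ S) ∧
      (∀ A ∈ S, ∀ B ∈ S, join A B ∈ S) ∧
      (∀ f : ℕ → ℕ → ℕ → ℕ, Bounded2Triples f →
        (∃ A ∈ S, ∃ F : ℕ → ℕ, FunRecIn A F ∧
          ∀ x y z : ℕ, x < y → y < z → F (Nat.pair x (Nat.pair y z)) = f x y z) →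
        ∃ X ∈ S, X.Infinite ∧ Rainbow3On f X) ∧
      W ∉ S := by
  choose E hE using exists_enum
  have step : ∀ O F : ℕ → ℕ, ∃ X : Set ℕ, Av (chi W) O → (AvX (chi W) O X ∧
      (Le F O → Bounded2Triples (colF F) → X.Infinite ∧ Rainbow3On (colF F) X)) := by
    intro O F
    by_cases h : Av (chi W) O ∧ Le F O ∧ Bounded2Triples (colF F)
    · obtain ⟨Y, h1, h2, h3⟩ := weak3 h.1 h.2.1 h.2.2
      exact ⟨Y, fun _ => ⟨h1, fun _ _ => ⟨h2, h3⟩⟩⟩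
    · exact ⟨Set.univ, fun hA => ⟨AvX.of_Le hA LeF.refl le_univ,
        fun h1 h2 => absurd ⟨hA, h1, h2⟩ h⟩⟩
  choose X hX using step
  let T : ℕ → (ℕ → ℕ) → ℕ → ℕ := fun k O => E (lp^[k - k.unpair.1] O) k.unpair.2
  let Q : ℕ → ℕ → ℕ := fun k => Nat.rec (chi ∅) (fun k O => opair O (chi (X O (T k O)))) k
  have hQ : ∀ k, Q (k + 1) = opair (Q k) (chi (X (Q k) (T k (Q k)))) := fun _ => rfl
  have hAv : ∀ k, Av (chi W) (Q k) := by
    intro k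
    induction k with
    | zero => exact fun h => hW (Le.rec h)
    | succ k ih => rw [hQ]; exact (hX _ _ ih).1
  have hlp : ∀ i j, lp^[i] (Q (j + i)) = Q j := by
    intro i j
    induction i with
    | zero => rfl
    | succ i ih => rw [Function.iterate_succ_apply, ← add_assoc, hQ, lp_opair, ih]
  have hmono : ∀ j i, Le (Q j) (Q (j + i)) := by
    intro j i
    induction i with
    | zero => exact LeF.refl
    | succ i ih => exact LeF.trans ih (by rw [← add_assoc, hQ]; exact Le.left')
  have hmono' : ∀ {j k}, j ≤ k → Le (Q j) (Q k) := by
    intro j k h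
    obtain ⟨i, rfl⟩ := Nat.exists_eq_add_of_le h
    exact hmono j i
  refine ⟨{A | ∃ k, Le (chi A) (Q k)}, ?_, ?_, ?_, ?_, ?_, ?_⟩
  · have : {A | ∃ k, Le (chi A) (Q k)} = ⋃ k, chi ⁻¹' {F | Le F (Q k)} := by ext; simp
    rw [this]
    refine Set.countable_iUnion fun k => (countable_le _).preimage_of_injOn ?_
    intro A _ B _ h
    ext x
    rw [← chi_one, h, chi_one]
  · intro A hA
    exact ⟨0, Le.of_rec hA⟩
  · rintro A ⟨k, hk⟩ B hB
    exact ⟨k, (Le.of_rec hB).trans hk⟩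
  · rintro A ⟨j, hj⟩ B ⟨k, hk⟩
    exact ⟨max j k, Le.join (hj.trans (hmono' (le_max_left _ _))) (hk.trans (hmono' (le_max_right _ _)))⟩
  · rintro f hf ⟨A, ⟨j, hj⟩, F, hF, hFf⟩
    have hFj : Le F (Q j) := (Le.of_rec hF).trans hj
    have hcol : ∀ x y z, x < y → y < z → colF F x y z = f x y z := hFf
    have hb : Bounded2Triples (colF F) := by
      intro c
      refine le_trans (Set.encard_le_encard ?_) (hf c)
      rintro ⟨x, y, z⟩ ⟨h1, h2, h3⟩
      exact ⟨h1, h2, by rw [← hcol _ _ _ h1 h2]; exact h3⟩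
    obtain ⟨e, he⟩ := hE _ F hFj
    have hjk : j ≤ Nat.pair j e := Nat.left_le_pair j e
    have hT : T (Nat.pair j e) (Q (Nat.pair j e)) = F := by
      simp only [T, Nat.unpair_pair]
      have := hlp (Nat.pair j e - j) j
      rw [Nat.add_sub_cancel' hjk] at this
      rw [this, he]
    obtain ⟨h1, h2⟩ := (hX _ F (hAv (Nat.pair j e))).2 (hFj.trans (hmono' hjk)) hb
    refine ⟨X (Q (Nat.pair j e)) F, ⟨Nat.pair j e + 1, ?_⟩, h1, ?_⟩
    · rw [hQ, hT]; exact Le.right'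
    · intro x y z x' y' z' hx hy hz hx' hy' hz' a1 a2 b1 b2 e
      refine h2 x y z x' y' z' hx hy hz hx' hy' hz' a1 a2 b1 b2 ?_
      rw [hcol _ _ _ a1 a2, hcol _ _ _ b1 b2, e]
  · rintro ⟨k, hk⟩
    exact hAv k hk

end RRT

namespace RRT

/-- RRT³₂ does not imply ACA₀, ω-model version: for every noncomputable
`W ⊆ ℕ` there is a countable collection `S` of subsets of ℕ which contains all computable
sets, is closed under Turing reducibility and join, contains an infinite rainbow for each
2-bounded coloring of `[ℕ]³` computable in some member of `S`, and omits `W`. -/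
theorem statement11 (W : Set ℕ) (hW : ¬ TuringLE W ∅) :
    ∃ S : Set (Set ℕ), S.Countable ∧
      (∀ A : Set ℕ, TuringLE A ∅ → A ∈ S) ∧
      (∀ A ∈ S, ∀ B : Set ℕ, TuringLE B A → B ∈ S) ∧
      (∀ A ∈ S, ∀ B ∈ S, join A B ∈ S) ∧
      (∀ f : ℕ → ℕ → ℕ → ℕ, Bounded2Triples f →
        (∃ A ∈ S, ∃ F : ℕ → ℕ, FunRecIn A F ∧
          ∀ x y z : ℕ, x < y → y < z → F (Nat.pair x (Nat.pair y z)) = f x y z) →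
        ∃ X ∈ S, X.Infinite ∧ Rainbow3On f X) ∧
      W ∉ S := by
  exact final W hW

end RRT
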